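/- arXiv:1202.5675 — 9 statements merged into one kernel-verified Lean document; each statement's English description precedes it below -/
import Mathlib

section
/- Let T be a finite simple graph on a vertex type V with at least 2 vertices, and suppose T is a tree (connected and acyclic). Let R be a subset of V with |R| = k such that every vertex of V not in R has degree at least 3 in T. Then |V| ≤ 2k − 2. -/
/-- In a tree with at least 2 vertices in which every non-terminal vertex has
degree at least 3, the number of vertices is at most `2k - 2`, where `k` is the
number of terminals. -/
theorem tree_nonterminal_degree_three_card_le
    {V : Type*} [Fintype V] (T : SimpleGraph V) [DecidableRel T.Adj]
    (hT : T.IsTree) (hV : 2 ≤ Fintype.card V)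
    (R : Finset V) (k : ℕ) (hR : R.card = k)
    (hdeg : ∀ v : V, v ∉ R → 3 ≤ T.degree v) :
    Fintype.card V ≤ 2 * k - 2 := by
  classical
  have : Nontrivial V := Fintype.one_lt_card_iff_nontrivial.mp hV
  have hsum := T.sum_degrees_eq_twice_card_edges
  have hedge := hT.card_edgeFinset
  have hsplit := Finset.sum_add_sum_compl R (fun v => T.degree v)
  have hterm : R.card * 1 ≤ ∑ v ∈ R, T.degree v :=
    Finset.card_nsmul_le_sum R _ 1 fun v _ =>
      hT.connected.preconnected.degree_pos_of_nontrivial v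
  have hnonterm : Rᶜ.card * 3 ≤ ∑ v ∈ Rᶜ, T.degree v :=
    Finset.card_nsmul_le_sum Rᶜ _ 3 fun v hv => hdeg v (Finset.mem_compl.mp hv)
  have hcard := Finset.card_add_card_compl R
  lia
end

section
/- Let T be a finite simple graph on a vertex type V that is a tree (connected and acyclic), equipped with nonnegative edge lengths ℓ : E(T) → ℝ, and let R ⊆ V be a set of k ≥ 2 vertices (terminals). Then there exist a finite simple graph T' on some vertex type V' with |V'| ≤ 2k − 2 that is a tree, nonnegative edge lengths ℓ' : E(T') → ℝ, and an injective map ι : R → V', such that for all u, v ∈ R the weighted length of the unique path in T' from ι(u) to ι(v) equals the weighted length of the unique path in T from u to v. -/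
namespace SimpleGraph

variable {V : Type*}

/-- The graph on `V \ {x}` in which the neighbours of `x` have been joined to each other. -/
def bypass (G : SimpleGraph V) (x : V) : SimpleGraph {v : V // v ≠ x} where
  Adj u v := u ≠ v ∧ (G.Adj u v ∨ G.Adj u x ∧ G.Adj x v)
  symm := ⟨fun _ _ h => ⟨h.1.symm, h.2.imp (·.symm) fun h' => ⟨h'.2.symm, h'.1.symm⟩⟩⟩
  loopless := ⟨fun _ h => h.1 rfl⟩

open Classical in
/-- The edge lengths on `G.bypass x`: edges of `G` keep their length, and a new edge has the length
of the two-edge detour through `x` that it replaces. -/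
noncomputable def bypassLength (G : SimpleGraph V) (ℓ : Sym2 V → ℝ) (x : V) :
    Sym2 {v : V // v ≠ x} → ℝ :=
  Sym2.lift ⟨fun u v => if G.Adj u v then ℓ s(↑u, ↑v) else ℓ s(↑u, x) + ℓ s(x, ↑v), fun u v => by
    beta_reduce
    rw [G.adj_comm u v, Sym2.eq_swap (a := (u : V)) (b := v), Sym2.eq_swap (a := (u : V)) (b := x),
      Sym2.eq_swap (a := x) (b := v), add_comm]⟩

open Classical in
lemma bypassLength_mk (G : SimpleGraph V) (ℓ : Sym2 V → ℝ) {x : V} (u v : {v : V // v ≠ x}) :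
    G.bypassLength ℓ x s(u, v) =
      if G.Adj u v then ℓ s(↑u, ↑v) else ℓ s(↑u, x) + ℓ s(x, ↑v) :=
  rfl

lemma bypassLength_nonneg {G : SimpleGraph V} {ℓ : Sym2 V → ℝ}
    (hℓ : ∀ e ∈ G.edgeSet, 0 ≤ ℓ e) (x : V) :
    ∀ e ∈ (G.bypass x).edgeSet, 0 ≤ G.bypassLength ℓ x e := by
  intro e
  induction e with | _ u v
  rintro ⟨-, h⟩
  rw [bypassLength_mk]
  split_ifs with huv
  · exact hℓ _ huv
  · obtain h | h := h
    · exact absurd h huv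
    · exact add_nonneg (hℓ _ h.1) (hℓ _ h.2)

lemma IsAcyclic.not_adj_of_adj_of_adj {G : SimpleGraph V} (hG : G.IsAcyclic) {u x v : V}
    (hux : G.Adj u x) (hxv : G.Adj x v) : ¬ G.Adj u v := by
  intro huv
  have h := (hG.subsingleton_path u v).elim (Path.singleton huv)
    ⟨.cons hux (.cons hxv .nil), by simp [hux.ne, huv.ne, hxv.ne]⟩
  have := congrArg (fun p => p.1.length) h
  simp at this

lemma IsAcyclic.exists_isPath_bypass {G : SimpleGraph V} (hG : G.IsAcyclic) (ℓ : Sym2 V → ℝ)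
    {x : V} (n : ℕ) : ∀ {u v : V} (hu : u ≠ x) (hv : v ≠ x) (p : G.Walk u v), p.length ≤ n →
      p.IsPath → ∃ q : (G.bypass x).Walk ⟨u, hu⟩ ⟨v, hv⟩, q.IsPath ∧
        (∀ w ∈ q.support, (w : V) ∈ p.support) ∧
        (q.edges.map (G.bypassLength ℓ x)).sum = (p.edges.map ℓ).sum := by
  induction n with
  | zero =>
    intro u v hu hv p hn hp
    cases p with
    | nil => exact ⟨.nil, by simp⟩
    | cons h p => simp at hn
  | succ n ih =>
    intro u v hu hv p hn hp
    cases p with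
    | nil => exact ⟨.nil, by simp⟩
    | @cons _ w _ h p =>
      rw [Walk.cons_isPath_iff] at hp
      rw [Walk.length_cons] at hn
      by_cases hw : w = x
      · subst hw
        cases p with
        | nil => exact absurd rfl hv
        | @cons _ y _ h' p =>
          simp only [Walk.cons_isPath_iff, Walk.support_cons, List.mem_cons, not_or,
            Walk.length_cons] at hp hn
          obtain ⟨q, hq, hs, hl⟩ := ih h'.ne' hv p (by lia) hp.1.1
          have hadj : (G.bypass w).Adj ⟨u, hu⟩ ⟨y, h'.ne'⟩ := by
            refine ⟨fun he => hp.2.2 ?_, .inr ⟨h, h'⟩⟩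
            have : u = y := congrArg Subtype.val he
            exact this ▸ p.start_mem_support
          refine ⟨.cons hadj q, ?_, ?_, ?_⟩
          · exact (Walk.cons_isPath_iff _ _).2 ⟨hq, fun hm => hp.2.2 (hs _ hm)⟩
          · simp only [Walk.support_cons, List.mem_cons]
            rintro z (rfl | hz)
            · simp
            · exact .inr (.inr (hs z hz))
          · simp [hl, bypassLength_mk, hG.not_adj_of_adj_of_adj h h', add_assoc]
      · obtain ⟨q, hq, hs, hl⟩ := ih hw hv p (by lia) hp.1
        have hadj : (G.bypass x).Adj ⟨u, hu⟩ ⟨w, hw⟩ :=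
          ⟨fun he => h.ne (congrArg Subtype.val he), .inl h⟩
        refine ⟨.cons hadj q, ?_, ?_, ?_⟩
        · exact (Walk.cons_isPath_iff _ _).2 ⟨hq, fun hm => hp.2 (hs _ hm)⟩
        · simp only [Walk.support_cons, List.mem_cons]
          rintro z (rfl | hz)
          · simp
          · exact .inr (hs z hz)
        · simp [hl, bypassLength_mk, h]

lemma IsTree.isTree_bypass [Fintype V] [Nontrivial V] {G : SimpleGraph V} (hG : G.IsTree)
    [DecidableRel G.Adj] {x : V} (hx : G.degree x ≤ 2) : (G.bypass x).IsTree := by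
  classical
  obtain ⟨a, ha⟩ : ∃ a, G.Adj x a := by
    rw [← degree_pos_iff_exists_adj]
    exact hG.1.preconnected.degree_pos_of_nontrivial x
  have : Nonempty {v : V // v ≠ x} := ⟨⟨a, ha.ne'⟩⟩
  have hconn : (G.bypass x).Connected := by
    refine ⟨fun u v => ?_⟩
    obtain ⟨p, hp, -⟩ := hG.existsUnique_path u v
    obtain ⟨q, -⟩ := hG.isAcyclic.exists_isPath_bypass 0 _ u.2 v.2 p le_rfl hp
    exact ⟨q⟩
  let f : V → {v : V // v ≠ x} := fun v => if h : v = x then ⟨a, ha.ne'⟩ else ⟨v, h⟩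
  have hfx : f x = ⟨a, ha.ne'⟩ := by simp [f]
  have hf (v : {v : V // v ≠ x}) : f v = v := by simp [f, v.2]
  have hab {u v : V} (hu : G.Adj x u) (hv : G.Adj x v) (huv : u ≠ v) : a = u ∨ a = v := by
    by_contra! h
    have : ({a, u, v} : Finset V) ⊆ G.neighborFinset x := by
      intro w
      simp only [Finset.mem_insert, Finset.mem_singleton, mem_neighborFinset]
      rintro (rfl | rfl | rfl) <;> assumption
    have := Finset.card_le_card this
    rw [Finset.card_eq_three.2 ⟨a, u, v, h.1, h.2, huv, rfl⟩, card_neighborFinset_eq_degree] at this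
    lia
  have hsub : (G.bypass x).edgeFinset ⊆ (G.edgeFinset.erase s(x, a)).image (Sym2.map f) := by
    intro e
    induction e with | _ u v
    simp only [mem_edgeFinset, mem_edgeSet, Finset.mem_image, Finset.mem_erase]
    rintro ⟨hne, h | ⟨hux, hxv⟩⟩
    · refine ⟨s(↑u, ↑v), ⟨?_, h⟩, by simp [hf]⟩
      have := u.2
      have := v.2
      simp only [ne_eq, Sym2.eq_iff]
      tauto
    · have hne' : (u : V) ≠ v := fun h => hne (Subtype.ext h)
      obtain rfl | rfl := hab hux.symm hxv hne'
      · exact ⟨s(x, ↑v), ⟨by simp [hne'.symm, v.2], hxv⟩, by simp [hf, hfx]⟩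
      · exact ⟨s(↑u, x), ⟨by simp [hne', u.2], hux⟩, by simp [hf, hfx]⟩
  have hcard := (Finset.card_le_card hsub).trans Finset.card_image_le
  rw [Finset.card_erase_of_mem (by simpa using ha)] at hcard
  have h₁ := hG.card_edgeFinset
  have h₂ := hconn.card_vert_le_card_edgeSet_add_one
  have h₃ : Fintype.card {v : V // v ≠ x} = Fintype.card V - 1 := by
    simp [Fintype.card_subtype_compl]
  have h₄ : 1 < Fintype.card V := Fintype.one_lt_card
  rw [isTree_iff_connected_and_card]
  refine ⟨hconn, ?_⟩
  simp only [Nat.card_eq_fintype_card, ← edgeFinset_card] at h₂ ⊢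
  lia

lemma IsTree.exists_degree_le_two_of_card_lt [Fintype V] {G : SimpleGraph V} (hG : G.IsTree)
    [DecidableRel G.Adj] [Nontrivial V] (R : Finset V)
    (hR : 2 * R.card - 2 < Fintype.card V) : ∃ x ∉ R, G.degree x ≤ 2 := by
  classical
  by_contra! h
  have h₁ : ∑ v, (if v ∈ R then 1 else 3) ≤ ∑ v, G.degree v := by
    refine Finset.sum_le_sum fun v _ => ?_
    split_ifs with hv
    · exact hG.1.preconnected.degree_pos_of_nontrivial v
    · exact h v hv
  have h₂ := hG.card_edgeFinset
  have h₃ := Finset.card_compl_add_card R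
  have h₄ : (Finset.univ.filter (· ∉ R)) = Rᶜ := by ext; simp
  rw [sum_degrees_eq_twice_card_edges, Finset.sum_ite, Finset.sum_const, Finset.sum_const, h₄,
    Finset.filter_univ_mem] at h₁
  simp only [smul_eq_mul] at h₁
  lia

/-- A weighted tree with terminals indexed by `S`, `2 ≤ |S|`, can be replaced by one on at most
`2|S| - 2` vertices that has the same terminal distances. -/
theorem IsTree.exists_small_isTree {S : Type*} [Fintype S] (hS : 2 ≤ Fintype.card S) (m : ℕ) :
    ∀ {V : Type*} [Fintype V] (T : SimpleGraph V) (_ : T.IsTree) (ℓ : Sym2 V → ℝ)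
      (_ : ∀ e ∈ T.edgeSet, 0 ≤ ℓ e) (f : S → V) (_ : Function.Injective f)
      (_ : Fintype.card V = m),
    ∃ (n : ℕ) (T' : SimpleGraph (Fin n)) (ℓ' : Sym2 (Fin n) → ℝ) (ι : S → Fin n),
      n ≤ 2 * Fintype.card S - 2 ∧ T'.IsTree ∧ (∀ e ∈ T'.edgeSet, 0 ≤ ℓ' e) ∧
      Function.Injective ι ∧ ∀ (u v : S) (p : T.Walk (f u) (f v)), p.IsPath →
        ∃ p' : T'.Walk (ι u) (ι v), p'.IsPath ∧
          (p'.edges.map ℓ').sum = (p.edges.map ℓ).sum := by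
  classical
  induction m with
  | zero =>
    intro V _ T hT ℓ hℓ f hf hV
    have := Fintype.card_le_of_injective f hf
    lia
  | succ m ih =>
    intro V _ T hT ℓ hℓ f hf hV
    obtain hle | hlt := le_or_gt (Fintype.card V) (2 * Fintype.card S - 2)
    · let e := Fintype.equivFin V
      let φ : T ≃g T.comap e.symm := (Iso.comap e.symm T).symm
      refine ⟨Fintype.card V, T.comap e.symm, ℓ ∘ Sym2.map e.symm, φ ∘ f, hle,
        φ.isTree_iff.1 hT, ?_, φ.injective.comp hf, ?_⟩
      · intro s
        induction s with | _ u v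
        exact fun h => hℓ _ h
      · intro u v p hp
        refine ⟨p.map φ.toHom, hp.map φ.injective, ?_⟩
        rw [Walk.edges_map, List.map_map]
        congr 1
        refine List.map_congr_left fun s _ => ?_
        have : e.symm ∘ φ.toHom = id := funext fun v => e.symm_apply_apply v
        rw [Function.comp_apply, Function.comp_apply, Sym2.map_map, this, Sym2.map_id, id]
    · have hV₁ : Fintype.card S ≤ Fintype.card V := Fintype.card_le_of_injective f hf
      have : Nontrivial V := Fintype.one_lt_card_iff_nontrivial.1 (by lia)
      obtain ⟨x, hxR, hx⟩ := hT.exists_degree_le_two_of_card_lt (Finset.univ.image f)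
        (by rwa [Finset.card_image_of_injective _ hf, Finset.card_univ])
      have hfx (u : S) : f u ≠ x := fun h => hxR (by simp [← h])
      obtain ⟨n, T', ℓ', ι, hn, hT', hℓ', hι, hd⟩ := ih (T.bypass x) (hT.isTree_bypass hx)
        (T.bypassLength ℓ x) (bypassLength_nonneg hℓ x) (fun u => ⟨f u, hfx u⟩)
        (fun u v h => hf (congrArg Subtype.val h)) (by simp [Fintype.card_subtype_compl, hV])
      refine ⟨n, T', ℓ', ι, hn, hT', hℓ', hι, fun u v p hp => ?_⟩
      obtain ⟨q, hq, -, hql⟩ := hT.isAcyclic.exists_isPath_bypass ℓ _ (hfx u) (hfx v) p le_rfl hp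
      obtain ⟨p', hp', hl⟩ := hd u v q hq
      exact ⟨p', hp', hl.trans hql⟩

end SimpleGraph

/-- Every weighted tree with `k ≥ 2` terminals admits a weighted tree on at most
`2k - 2` vertices that exactly preserves all terminal-to-terminal path lengths. -/
theorem tree_distance_preserving_small
    {V : Type*} [Fintype V] (T : SimpleGraph V) (hT : T.IsTree)
    (ℓ : Sym2 V → ℝ) (hℓ : ∀ e ∈ T.edgeSet, 0 ≤ ℓ e)
    (R : Finset V) (k : ℕ) (hk : 2 ≤ k) (hR : R.card = k) :
    ∃ (n : ℕ) (T' : SimpleGraph (Fin n)) (ℓ' : Sym2 (Fin n) → ℝ)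
      (ι : {x // x ∈ R} → Fin n),
      n ≤ 2 * k - 2 ∧ T'.IsTree ∧ (∀ e ∈ T'.edgeSet, 0 ≤ ℓ' e) ∧
      Function.Injective ι ∧
      ∀ (u v : {x // x ∈ R}) (p : T.Walk u.1 v.1) (p' : T'.Walk (ι u) (ι v)),
        p.IsPath → p'.IsPath →
        (p'.edges.map ℓ').sum = (p.edges.map ℓ).sum := by
  have hS : Fintype.card {x // x ∈ R} = k := by simpa using hR
  obtain ⟨n, T', ℓ', ι, hn, hT', hℓ', hι, hd⟩ :=
    SimpleGraph.IsTree.exists_small_isTree (S := {x // x ∈ R}) (hS ▸ hk) _ T hT ℓ hℓ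
      Subtype.val Subtype.val_injective rfl
  refine ⟨n, T', ℓ', ι, hS ▸ hn, hT', hℓ', hι, fun u v p p' hp hp' => ?_⟩
  obtain ⟨q, hq, hl⟩ := hd u v p hp
  have hpq : p' = q :=
    congrArg Subtype.val ((hT'.isAcyclic.subsingleton_path _ _).elim ⟨p', hp'⟩ ⟨q, hq⟩)
  rw [hpq, hl]
end

section
/- Fix i ≥ 1 and let k = 2^i. Consider the metric on the set L = (Fin i → Bool) of Boolean strings of length i defined by d(u,v) = 2·(i − m(u,v)), where m(u,v) is the length of the longest common prefix of u and v (the largest m ≤ i such that u and v agree on all coordinates j < m); this is the shortest-path metric between the leaves of the complete binary tree of depth i with unit edge lengths. Then every finite simple graph T' on a vertex type V' that is a tree (connected and acyclic), equipped with strictly positive edge lengths ℓ' : E(T') → ℝ and an injective map ι : L → V' such that for all u, v ∈ L the weighted length of the unique path in T' from ι(u) to ι(v) equals d(u,v), satisfies |V'| ≥ 2k − 2. -/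
namespace SimpleGraph

variable {V : Type*} {G : SimpleGraph V}

/-- A walk ending in a set `S` can be shortened to a path that meets `S` only at its endpoint. -/
theorem Walk.exists_isPath_first_hit (S : Set V) {y x : V} (p : G.Walk y x) (hx : x ∈ S) :
    ∃ c ∈ S, ∃ q : G.Walk y c, q.IsPath ∧ ∀ v ∈ q.support, v ∈ S → v = c := by
  classical
  suffices h : ∃ c ∈ S, ∃ q : G.Walk y c, ∀ v ∈ q.support, v ∈ S → v = c by
    obtain ⟨c, hc, q, hq⟩ := h
    exact ⟨c, hc, q.bypass, q.bypass_isPath,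
      fun v hv => hq v (q.support_bypass_subset_support hv)⟩
  induction p with
  | nil => exact ⟨_, hx, .nil, by simp⟩
  | @cons u v w h p ih =>
    by_cases hu : u ∈ S
    · exact ⟨u, hu, .nil, by simp⟩
    · obtain ⟨c, hc, q, hq⟩ := ih hx
      refine ⟨c, hc, .cons h q, fun t ht htS => ?_⟩
      rcases List.mem_cons.mp (Walk.support_cons h q ▸ ht) with rfl | ht
      · exact absurd htS hu
      · exact hq t ht htS

theorem Walk.IsPath.append_of_forall_eq {u v w : V} {p : G.Walk u v} {q : G.Walk v w}
    (hp : p.IsPath) (hq : q.IsPath) (h : ∀ t ∈ p.support, t ∈ q.support → t = v) :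
    (p.append q).IsPath := by
  rw [Walk.isPath_def, Walk.support_append, List.nodup_append']
  refine ⟨hp.support_nodup, hq.support_nodup.tail, fun t ht ht' => ?_⟩
  obtain rfl := h t ht (List.mem_of_mem_tail ht')
  have hn := hq.support_nodup
  rw [← Walk.cons_tail_support] at hn
  exact (List.nodup_cons.mp hn).1 ht'

/-- The weighted length of the path between two vertices of a tree. -/
noncomputable def IsTree.pathWeight (hG : G.IsTree) (ℓ : Sym2 V → ℝ) (u v : V) : ℝ :=
  ((hG.existsUnique_path u v).choose.edges.map ℓ).sum

namespace IsTree

theorem exists_isPath (hG : G.IsTree) (u v : V) : ∃ p : G.Walk u v, p.IsPath :=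
  (hG.existsUnique_path u v).exists

variable (hG : G.IsTree) (ℓ : Sym2 V → ℝ)

theorem pathWeight_eq {u v : V} (p : G.Walk u v) (hp : p.IsPath) :
    hG.pathWeight ℓ u v = (p.edges.map ℓ).sum := by
  rw [pathWeight, (hG.existsUnique_path u v).unique
    (hG.existsUnique_path u v).choose_spec.1 hp]

theorem pathWeight_comm (u v : V) : hG.pathWeight ℓ u v = hG.pathWeight ℓ v u := by
  obtain ⟨p, hp⟩ := hG.exists_isPath u v
  rw [hG.pathWeight_eq ℓ p hp, hG.pathWeight_eq ℓ p.reverse hp.reverse, Walk.edges_reverse,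
    List.map_reverse, List.sum_reverse]

theorem pathWeight_self (u : V) : hG.pathWeight ℓ u u = 0 := by
  simp [hG.pathWeight_eq ℓ (.nil : G.Walk u u) .nil]

theorem pathWeight_triangle (hℓ : ∀ e ∈ G.edgeSet, 0 ≤ ℓ e) (u v w : V) :
    hG.pathWeight ℓ u w ≤ hG.pathWeight ℓ u v + hG.pathWeight ℓ v w := by
  classical
  obtain ⟨p, hp⟩ := hG.exists_isPath u v
  obtain ⟨q, hq⟩ := hG.exists_isPath v w
  rw [hG.pathWeight_eq ℓ p hp, hG.pathWeight_eq ℓ q hq,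
    hG.pathWeight_eq ℓ _ (p.append q).bypass_isPath, ← List.sum_append, ← List.map_append,
    ← Walk.edges_append]
  refine ((p.append q).edges_bypass_sublist_edges.map ℓ).sum_le_sum fun a ha => ?_
  obtain ⟨e, he, rfl⟩ := List.mem_map.mp ha
  exact hℓ e (Walk.edges_subset_edgeSet _ he)

/-- Any three vertices of a tree have a median. -/
theorem exists_median (x y z : V) : ∃ c,
    hG.pathWeight ℓ x y = hG.pathWeight ℓ c x + hG.pathWeight ℓ c y ∧
    hG.pathWeight ℓ x z = hG.pathWeight ℓ c x + hG.pathWeight ℓ c z ∧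
    hG.pathWeight ℓ y z = hG.pathWeight ℓ c y + hG.pathWeight ℓ c z := by
  classical
  obtain ⟨p, hp⟩ := hG.exists_isPath x z
  obtain ⟨r, -⟩ := hG.exists_isPath y x
  obtain ⟨c, hc, q, hq, hqc⟩ :=
    r.exists_isPath_first_hit {v | v ∈ p.support} p.start_mem_support
  have ha := hp.takeUntil hc
  have hb := hp.dropUntil hc
  have hxy := ha.append_of_forall_eq hq.reverse fun t ht ht' =>
    hqc t (by simpa using ht') (p.support_takeUntil_subset_support hc ht)
  have hyz := hq.append_of_forall_eq hb fun t ht ht' =>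
    hqc t ht (p.support_dropUntil_subset_support hc ht')
  have hxz : ((p.takeUntil c hc).append (p.dropUntil c hc)).IsPath := by rwa [p.take_spec hc]
  refine ⟨c, ?_, ?_, ?_⟩
  · rw [hG.pathWeight_comm ℓ c x, hG.pathWeight_comm ℓ c y, hG.pathWeight_eq ℓ _ hxy,
      hG.pathWeight_eq ℓ _ ha, hG.pathWeight_eq ℓ _ hq]
    simp
  · rw [hG.pathWeight_comm ℓ c x, hG.pathWeight_eq ℓ _ hxz,
      hG.pathWeight_eq ℓ _ ha, hG.pathWeight_eq ℓ _ hb, Walk.edges_append, List.map_append,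
      List.sum_append]
  · rw [hG.pathWeight_comm ℓ c y, hG.pathWeight_eq ℓ _ hyz,
      hG.pathWeight_eq ℓ _ hq, hG.pathWeight_eq ℓ _ hb]
    simp

end IsTree

end SimpleGraph

/-- The length of the longest common prefix of two strings. -/
def commonPrefixLength {i : ℕ} (u v : Fin i → Bool) : ℕ :=
  ((Finset.range (i + 1)).filter (fun m => ∀ j : Fin i, (j : ℕ) < m → u j = v j)).sup id

theorem commonPrefixLength_le {i : ℕ} {u v : Fin i → Bool} {k : Fin i} (h : u k ≠ v k) :
    commonPrefixLength u v ≤ k := by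
  refine Finset.sup_le fun m hm => ?_
  by_contra! hk
  exact h ((Finset.mem_filter.mp hm).2 k hk)

theorem commonPrefixLength_eq {i : ℕ} {u v : Fin i → Bool} {k : Fin i} (h : u k ≠ v k)
    (hlt : ∀ j < k, u j = v j) : commonPrefixLength u v = k :=
  (commonPrefixLength_le h).antisymm <|
    Finset.le_sup (f := id) (Finset.mem_filter.mpr
      ⟨Finset.mem_range.mpr (k.2.trans (Nat.lt_succ_self i)), hlt⟩)


/-- Lower bound `f*(k, Trees) ≥ 2k - 2` for `k = 2^i`: every weighted tree with
strictly positive edge lengths realizing the leaf metric of the complete binary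
tree of depth `i` (with unit edge lengths) has at least `2·2^i - 2` vertices.
Here the leaf metric on Boolean strings `u v : Fin i → Bool` is
`d(u,v) = 2(i - m(u,v))`, where `m(u,v)` is the length of the longest common
prefix of `u` and `v`. -/
theorem complete_binary_tree_leaf_metric_lower_bound
    (i : ℕ) (hi : 1 ≤ i)
    {V' : Type*} [Fintype V'] (T' : SimpleGraph V') (hT' : T'.IsTree)
    (ℓ' : Sym2 V' → ℝ) (hℓ' : ∀ e ∈ T'.edgeSet, 0 < ℓ' e)
    (ι : (Fin i → Bool) → V') (hι : Function.Injective ι)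
    (hdist : ∀ (u v : Fin i → Bool) (p : T'.Walk (ι u) (ι v)), p.IsPath →
      (p.edges.map ℓ').sum =
        2 * ((i : ℝ) -
          (((Finset.range (i + 1)).filter
            (fun m => ∀ j : Fin i, (j : ℕ) < m → u j = v j)).sup id : ℕ))) :
    2 * 2 ^ i - 2 ≤ Fintype.card V' := by
  have hw : ∀ e ∈ T'.edgeSet, 0 ≤ ℓ' e := fun e he => (hℓ' e he).le
  set D := hT'.pathWeight ℓ' with hD
  have hDι (u v) : D (ι u) (ι v) = 2 * ((i : ℝ) - (commonPrefixLength u v : ℕ)) := by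
    obtain ⟨p, hp⟩ := hT'.exists_isPath (ι u) (ι v)
    rw [hD, hT'.pathWeight_eq ℓ' p hp]
    exact hdist u v p hp
  let o : Fin i := ⟨0, hi⟩
  let z : Bool → Fin i → Bool := fun b _ => !b
  have hz {u v : Fin i → Bool} (h : u o ≠ v o) : D (ι u) (ι v) = 2 * i := by
    rw [hDι, commonPrefixLength_eq h fun j hj => absurd hj (Nat.not_lt_zero _)]
    simp [o]
  -- the vertex above `x` at height `i - (m + 1)`
  have key (m : Fin i) (x : Fin i → Bool) :
      ∃ c, D c (ι x) = i - (m + 1) ∧ D c (ι (z (x o))) = i + (m + 1) := by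
    have hxz : D (ι x) (ι (z (x o))) = 2 * i := hz (by simp [z])
    rcases Nat.lt_or_ge (m + 1) i with hm | hm
    · let k : Fin i := ⟨m + 1, hm⟩
      let y := Function.update x k (!x k)
      have hyo : y o = x o := Function.update_of_ne (by simp [o, k, Fin.ext_iff]) _ _
      have hyz : D (ι y) (ι (z (x o))) = 2 * i := hz (by simp [z, hyo])
      have hxy : D (ι x) (ι y) = 2 * (i - (m + 1)) := by
        rw [hDι, commonPrefixLength_eq (k := k) (by simp [y]) fun j hj => by
          simp [y, Function.update_of_ne hj.ne]]
        simp [k]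
      obtain ⟨c, h1, h2, h3⟩ := hT'.exists_median ℓ' (ι x) (ι y) (ι (z (x o)))
      rw [← hD] at h1 h2 h3
      exact ⟨c, by linarith, by linarith⟩
    · have hmi : (i : ℝ) = m + 1 := by exact_mod_cast le_antisymm hm m.2
      refine ⟨ι x, ?_, ?_⟩
      · rw [hD, hT'.pathWeight_self]; linarith
      · linarith
  choose c hcx hcz using key
  let ext (m : Fin i) (w : Fin (m + 1) → Bool) : Fin i → Bool :=
    fun j => if h : (j : ℕ) < m + 1 then w ⟨j, h⟩ else false
  let f : (Σ m : Fin i, Fin (m + 1) → Bool) → V' := fun s => c s.1 (ext s.1 s.2)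
  have hf : Function.Injective f := by
    rintro ⟨m, w⟩ ⟨m', w'⟩ (h : c m (ext m w) = c m' (ext m' w'))
    have h1 := hcx m (ext m w)
    have h2 := hcz m (ext m w)
    have h1' := hcx m' (ext m' w')
    have h2' := hcz m' (ext m' w')
    rw [← h] at h1' h2'
    have tri := hT'.pathWeight_triangle ℓ' hw (ι (ext m w)) (c m (ext m w)) (ι (ext m' w'))
    rw [← hD, hD, hT'.pathWeight_comm ℓ' (ι (ext m w)) (c m (ext m w)), ← hD, h1, h1'] at tri
    by_cases ho : ext m w o = ext m' w' o
    · rw [← ho, h2] at h2'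
      obtain rfl : m = m' := Fin.ext (by exact_mod_cast (by linarith : ((m : ℕ) : ℝ) = (m' : ℕ)))
      congr 1
      funext j
      by_contra hj
      have hji : (j : ℕ) < i := by have := j.2; have := m.2; omega
      have hne : ext m w ⟨j, hji⟩ ≠ ext m w' ⟨j, hji⟩ := by
        simp only [ext]
        rwa [dif_pos j.2, dif_pos j.2]
      have hle : commonPrefixLength (ext m w) (ext m w') ≤ (m : ℕ) :=
        (commonPrefixLength_le hne).trans (Nat.lt_succ_iff.mp j.2)
      have hle' : (commonPrefixLength (ext m w) (ext m w') : ℝ) ≤ (m : ℕ) := by exact_mod_cast hle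
      rw [hDι] at tri
      linarith
    · rw [hz ho] at tri
      have : (0 : ℝ) ≤ (m : ℕ) := Nat.cast_nonneg _
      have : (0 : ℝ) ≤ (m' : ℕ) := Nat.cast_nonneg _
      linarith
  have hcard : ∀ n : ℕ, ∑ m : Fin n, 2 ^ ((m : ℕ) + 1) = 2 * 2 ^ n - 2 := by
    intro n
    rw [Fin.sum_univ_eq_sum_range (fun m => 2 ^ (m + 1))]
    induction n with
    | zero => simp
    | succ n ih =>
      rw [Finset.sum_range_succ, ih, pow_succ]
      have := Nat.one_le_two_pow (n := n)
      omega
  calc 2 * 2 ^ i - 2 = Fintype.card (Σ m : Fin i, Fin (m + 1) → Bool) := by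
        simp [hcard]
    _ ≤ Fintype.card V' := Fintype.card_le_of_injective f hf
end

section
/- Let G be a finite simple graph in which shortest paths are unique: for all vertices u, v and any two paths p, q from u to v whose lengths both equal the graph distance dist_G(u,v), one has p = q, and moreover the reverse of a shortest path from u to v is the unique shortest path from v to u. Let p be a path from a to b with length equal to dist_G(a,b) and q a path from c to d with length equal to dist_G(c,d), and suppose p and q have at least one common vertex. Then the set of vertices lying on both p and q appears consecutively along p: there exist walks p₁, p₂, p₃ with p = p₁ ++ p₂ ++ p₃ such that a vertex lies on both p and q if and only if it lies on p₂. -/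
namespace SimpleGraph.Walk

variable {V : Type*} {G : SimpleGraph V}

/-- A walk meeting a set splits at its first vertex in that set. -/
theorem exists_append_first_mem {a b : V} (p : G.Walk a b) (s : Set V)
    (h : ∃ x ∈ p.support, x ∈ s) :
    ∃ (w : V) (p₁ : G.Walk a w) (p₂ : G.Walk w b), p = p₁.append p₂ ∧ w ∈ s ∧
      ∀ y ∈ p₁.support, y ∈ s → y = w := by
  induction p with
  | nil =>
    obtain ⟨x, hx, hxs⟩ := h
    rw [support_nil, List.mem_singleton] at hx
    subst hx
    exact ⟨x, nil, nil, rfl, hxs, by simp⟩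
  | @cons u v b e p ih =>
    by_cases hu : u ∈ s
    · exact ⟨u, nil, cons e p, rfl, hu, by simp⟩
    · obtain ⟨x, hx, hxs⟩ := h
      rw [support_cons, List.mem_cons] at hx
      obtain ⟨w, p₁, p₂, rfl, hw, hfirst⟩ :=
        ih ⟨x, hx.resolve_left fun hxu => hu (hxu ▸ hxs), hxs⟩
      refine ⟨w, cons e p₁, p₂, rfl, hw, fun y hy hys => ?_⟩
      rw [support_cons, List.mem_cons] at hy
      exact hfirst y (hy.resolve_left fun hyu => hu (hyu ▸ hys)) hys

/-- A walk meeting a set splits at its last vertex in that set. -/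
theorem exists_append_last_mem {a b : V} (p : G.Walk a b) (s : Set V)
    (h : ∃ x ∈ p.support, x ∈ s) :
    ∃ (w : V) (p₁ : G.Walk a w) (p₂ : G.Walk w b), p = p₁.append p₂ ∧ w ∈ s ∧
      ∀ y ∈ p₂.support, y ∈ s → y = w := by
  obtain ⟨w, p₁, p₂, hp, hw, hfirst⟩ := p.reverse.exists_append_first_mem s (by simpa using h)
  refine ⟨w, p₂.reverse, p₁.reverse, ?_, hw, by simpa using hfirst⟩
  rw [← reverse_append, ← hp, reverse_reverse]

/-- Any two vertices of a walk are joined, in one of the two directions, by a subwalk. -/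
theorem exists_isSubwalk_or_of_mem_support {c d w x : V} (q : G.Walk c d)
    (hw : w ∈ q.support) (hx : x ∈ q.support) :
    (∃ r : G.Walk w x, r.IsSubwalk q) ∨ ∃ r : G.Walk x w, r.IsSubwalk q := by
  classical
  have hw' := hw
  rw [← q.take_spec hx, mem_support_append_iff] at hw'
  rcases hw' with h | h
  · exact .inl ⟨(q.takeUntil x hx).dropUntil w h,
      (isSubwalk_dropUntil _ h).trans (q.isSubwalk_takeUntil hx)⟩
  · exact .inr ⟨(q.dropUntil x hx).takeUntil w h,
      (isSubwalk_takeUntil _ h).trans (q.isSubwalk_dropUntil hx)⟩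

end SimpleGraph.Walk

/-- In a graph with unique shortest paths (and with reverses of shortest paths
being the unique shortest paths in the opposite direction), the common vertices
of two shortest paths form a contiguous segment of each path: there is a
decomposition `p = p₁ ++ p₂ ++ p₃` such that a vertex lies on both `p` and `q`
iff it lies on `p₂`. -/
theorem shortest_paths_branch_contiguously
    {V : Type*} [Fintype V] (G : SimpleGraph V)
    (huniq : ∀ (u v : V) (p q : G.Walk u v), p.IsPath → q.IsPath →
      p.length = G.dist u v → q.length = G.dist u v → p = q)
    (hrev : ∀ (u v : V) (p : G.Walk u v) (q : G.Walk v u),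
      p.IsPath → p.length = G.dist u v →
      q.IsPath → q.length = G.dist v u → q = p.reverse)
    {a b c d : V} (p : G.Walk a b) (q : G.Walk c d)
    (hp : p.IsPath) (hpl : p.length = G.dist a b)
    (hq : q.IsPath) (hql : q.length = G.dist c d)
    (hcommon : ∃ x, x ∈ p.support ∧ x ∈ q.support) :
    ∃ (w x : V) (p₁ : G.Walk a w) (p₂ : G.Walk w x) (p₃ : G.Walk x b),
      p = (p₁.append p₂).append p₃ ∧
      ∀ y : V, (y ∈ p.support ∧ y ∈ q.support) ↔ y ∈ p₂.support := by
  obtain ⟨x, p', p₃, rfl, hxq, hlast⟩ := p.exists_append_last_mem {v | v ∈ q.support} hcommon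
  obtain ⟨w, p₁, p₂, rfl, hwq, hfirst⟩ :=
    p'.exists_append_first_mem {v | v ∈ q.support} ⟨x, p'.end_mem_support, hxq⟩
  refine ⟨w, x, p₁, p₂, p₃, rfl, fun y => ⟨?_, fun hy => ⟨by simp [hy], ?_⟩⟩⟩
  · rintro ⟨hyp, hyq⟩
    rw [SimpleGraph.Walk.mem_support_append_iff, SimpleGraph.Walk.mem_support_append_iff] at hyp
    rcases hyp with (hy | hy) | hy
    · exact hfirst y hy hyq ▸ p₂.start_mem_support
    · exact hy
    · exact hlast y hy hyq ▸ p₂.end_mem_support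
  · have hp₂ : p₂.length = G.dist w x :=
      SimpleGraph.length_eq_dist_of_subwalk hpl ⟨p₁, p₃, rfl⟩
    have hp₂' := p₂.isPath_of_length_eq_dist hp₂
    rcases q.exists_isSubwalk_or_of_mem_support hwq hxq with ⟨r, hr⟩ | ⟨r, hr⟩
    all_goals
      have hrl := SimpleGraph.length_eq_dist_of_subwalk hql hr
      have hr' := r.isPath_of_length_eq_dist hrl
    · exact hr.support_subset (huniq w x p₂ r hp₂' hr' hp₂ hrl ▸ hy)
    · have hyr : y ∈ r.support := by
        rw [hrev w x p₂ r hp₂' hp₂ hr' hrl]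
        simpa using hy
      exact hr.support_subset hyr
end

section
/- Let G be a finite connected simple graph with unique shortest paths: for all vertices u, v and any two paths p, q from u to v whose lengths both equal dist_G(u,v), one has p = q, and the reverse of a shortest path from u to v is the unique shortest path from v to u. Let R be a set of k ≥ 2 vertices (terminals), and for each unordered pair {u,v} of distinct terminals let p_{uv} be a shortest path from u to v. Let H be the subgraph of G whose edge set is the union of the edge sets of all the paths p_{uv}. Then the number of vertices whose degree in H is at least 3 is at most k⁴. -/
namespace SimpleGraph

variable {V : Type*} {G : SimpleGraph V}

/-- Every vertex of a shortest walk lies metrically between its endpoints. -/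
theorem Walk.dist_add_dist_of_mem_support {u v x : V} (p : G.Walk u v)
    (hp : p.length = G.dist u v) (hx : x ∈ p.support) :
    G.dist u x + G.dist x v = G.dist u v := by
  classical
  have hlen := congrArg Walk.length (p.take_spec hx)
  rw [Walk.length_append] at hlen
  have h₁ := dist_le (p.takeUntil x hx)
  have h₂ := dist_le (p.dropUntil x hx)
  have h₃ := (p.takeUntil x hx).reachable.dist_triangle_left v
  omega

/-- The endpoints of an edge of a shortest walk are at consecutive distances from its source. -/
theorem Walk.dist_eq_succ_of_mem_edges {u v x y : V} (p : G.Walk u v)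
    (hp : p.length = G.dist u v) (hxy : s(x, y) ∈ p.edges) :
    G.dist u y = G.dist u x + 1 ∨ G.dist u x = G.dist u y + 1 := by
  classical
  have key : ∀ {u v : V} (p : G.Walk u v), p.length = G.dist u v → s(x, y) ∈ p.edges →
      G.dist u x ≠ G.dist u y := by
    intro u v p
    induction p with
    | nil => simp
    | @cons a b c h p ih =>
      intro hp he hd
      have hb := (Walk.cons h p).dist_add_dist_of_mem_support hp (x := b) (by simp)
      have hab : G.dist a b = 1 := dist_eq_one_iff_adj.2 h
      rw [Walk.length_cons] at hp
      have hpl : p.length = G.dist b c := by omega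
      have hz : ∀ z ∈ p.support, G.dist a z = G.dist b z + 1 := by
        intro z hz
        have h₁ := p.dist_add_dist_of_mem_support hpl hz
        have h₂ := (Walk.cons h p).dist_add_dist_of_mem_support (by simpa using hp) (x := z)
          (by simp [hz])
        omega
      rw [Walk.edges_cons, List.mem_cons] at he
      rcases he with he | he
      · rw [Sym2.eq_iff] at he
        rcases he with ⟨rfl, rfl⟩ | ⟨rfl, rfl⟩ <;> simp [hab] at hd
      · have hx := hz x (p.fst_mem_support_of_mem_edges he)
        have hy := hz y (p.snd_mem_support_of_mem_edges he)
        exact ih hpl he (by omega)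
  have hne := key p hp hxy
  have hadj := p.adj_of_mem_edges hxy
  have h₁ := hadj.reachable.dist_triangle_right u
  have h₂ := hadj.symm.reachable.dist_triangle_right u
  have h₃ : G.dist x y = 1 := dist_eq_one_iff_adj.2 hadj
  have h₄ : G.dist y x = 1 := dist_eq_one_iff_adj.2 hadj.symm
  omega

/-- A graph is geodetic if any two shortest paths with the same endpoints coincide. -/
def IsGeodetic (G : SimpleGraph V) : Prop :=
  ∀ (u v : V) (p q : G.Walk u v), p.IsPath → q.IsPath →
    p.length = G.dist u v → q.length = G.dist u v → p = q

/-- In a geodetic graph, the points between `a` and `b` are linearly ordered by their distance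
from `a`. -/
theorem IsGeodetic.dist_add_dist (hG : G.IsGeodetic) (hconn : G.Connected) {a b x y : V}
    (hx : G.dist a x + G.dist x b = G.dist a b) (hy : G.dist a y + G.dist y b = G.dist a b)
    (hxy : G.dist a x ≤ G.dist a y) : G.dist a x + G.dist x y = G.dist a y := by
  classical
  obtain ⟨p₁, hp₁⟩ := hconn.exists_walk_length_eq_dist a x
  obtain ⟨p₂, hp₂⟩ := hconn.exists_walk_length_eq_dist x b
  obtain ⟨q₁, hq₁⟩ := hconn.exists_walk_length_eq_dist a y
  obtain ⟨q₂, hq₂⟩ := hconn.exists_walk_length_eq_dist y b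
  have hpl : (p₁.append p₂).length = G.dist a b := by rw [Walk.length_append]; omega
  have hql : (q₁.append q₂).length = G.dist a b := by rw [Walk.length_append]; omega
  have hpq := hG a b _ _ (Walk.isPath_of_length_eq_dist _ hpl)
    (Walk.isPath_of_length_eq_dist _ hql) hpl hql
  have hy' : y ∈ (p₁.append p₂).support := by
    rw [hpq, Walk.mem_support_append_iff]
    exact Or.inl q₁.end_mem_support
  rw [Walk.mem_support_append_iff] at hy'
  rcases hy' with h | h
  · have h₁ := p₁.dist_add_dist_of_mem_support hp₁ h
    rw [G.dist_comm (u := x)]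
    omega
  · have h₁ := p₂.dist_add_dist_of_mem_support hp₂ h
    omega

theorem IsGeodetic.eq_of_dist_eq (hG : G.IsGeodetic) (hconn : G.Connected) {a b x y : V}
    (hx : G.dist a x + G.dist x b = G.dist a b) (hy : G.dist a y + G.dist y b = G.dist a b)
    (hxy : G.dist a x = G.dist a y) : x = y := by
  have h := hG.dist_add_dist hconn hx hy hxy.le
  exact hconn.dist_eq_zero_iff.1 (by omega)

/-- In a geodetic graph, the shortest path contains every edge that lies metrically between its
endpoints. -/
theorem IsGeodetic.mem_edges (hG : G.IsGeodetic) (hconn : G.Connected) {u v x y : V}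
    (p : G.Walk u v) (hp : p.length = G.dist u v) (hadj : G.Adj x y)
    (h : G.dist u x + 1 + G.dist y v = G.dist u v) : s(x, y) ∈ p.edges := by
  obtain ⟨p₁, hp₁⟩ := hconn.exists_walk_length_eq_dist u x
  obtain ⟨p₂, hp₂⟩ := hconn.exists_walk_length_eq_dist y v
  have hl : (p₁.append (Walk.cons hadj p₂)).length = G.dist u v := by
    rw [Walk.length_append, Walk.length_cons]; omega
  rw [hG u v p _ (Walk.isPath_of_length_eq_dist _ hp) (Walk.isPath_of_length_eq_dist _ hl) hp hl]
  simp

/-- In a geodetic graph, if an edge lies between two vertices of a shortest path, then it belongs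
to that path. -/
theorem IsGeodetic.mem_edges_of_between (hG : G.IsGeodetic) (hconn : G.Connected)
    {u v x x' y z : V} (p : G.Walk u v) (hp : p.length = G.dist u v) (hadj : G.Adj x x')
    (hy : G.dist u y + G.dist y v = G.dist u v) (hz : G.dist u z + G.dist z v = G.dist u v)
    (h : G.dist y x + 1 + G.dist x' z = G.dist y z) : s(x, x') ∈ p.edges := by
  rcases le_total (G.dist u y) (G.dist u z) with hyz | hyz
  · have h₁ := hG.dist_add_dist hconn hy hz hyz
    have h₂ : G.dist u x ≤ G.dist u y + G.dist y x := hconn.dist_triangle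
    have h₃ : G.dist x' v ≤ G.dist x' z + G.dist z v := hconn.dist_triangle
    have h₄ : G.dist u v ≤ G.dist u x + G.dist x v := hconn.dist_triangle
    have h₅ : G.dist x v ≤ G.dist x x' + G.dist x' v := hconn.dist_triangle
    have h₆ : G.dist x x' = 1 := dist_eq_one_iff_adj.2 hadj
    exact hG.mem_edges hconn p hp hadj (by omega)
  · have h₁ := hG.dist_add_dist hconn hz hy hyz
    have h₂ : G.dist u x' ≤ G.dist u z + G.dist z x' := hconn.dist_triangle
    have h₃ : G.dist x v ≤ G.dist x y + G.dist y v := hconn.dist_triangle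
    have h₄ : G.dist u v ≤ G.dist u x' + G.dist x' v := hconn.dist_triangle
    have h₅ : G.dist x' v ≤ G.dist x' x + G.dist x v := hconn.dist_triangle
    have h₆ : G.dist x' x = 1 := dist_eq_one_iff_adj.2 hadj.symm
    have h₇ := G.dist_comm (u := z) (v := x')
    have h₈ := G.dist_comm (u := x) (v := y)
    have h₉ := G.dist_comm (u := z) (v := y)
    rw [Sym2.eq_swap]
    exact hG.mem_edges hconn p hp hadj.symm (by omega)

/-- In a geodetic graph, an edge at `x` of the shortest path `q` which lies between vertices `y`
and `z` of `p` on either side of `x` also belongs to `p`. -/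
theorem IsGeodetic.mem_edges_of_mem_edges (hG : G.IsGeodetic) (hconn : G.Connected)
    {u v a b x x' y z : V} (p : G.Walk u v) (hp : p.length = G.dist u v)
    (q : G.Walk a b) (hq : q.length = G.dist a b) (he : s(x, x') ∈ q.edges)
    (hyp : G.dist u y + G.dist y v = G.dist u v) (hyq : G.dist a y + G.dist y b = G.dist a b)
    (hzp : G.dist u z + G.dist z v = G.dist u v) (hzq : G.dist a z + G.dist z b = G.dist a b)
    (hyx : G.dist a y < G.dist a x) (hxz : G.dist a x < G.dist a z) : s(x, x') ∈ p.edges := by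
  have hadj := q.adj_of_mem_edges he
  have hx := q.dist_add_dist_of_mem_support hq (q.fst_mem_support_of_mem_edges he)
  have hx' := q.dist_add_dist_of_mem_support hq (q.snd_mem_support_of_mem_edges he)
  have h₁ := hG.dist_add_dist hconn hyq hx hyx.le
  have h₂ := hG.dist_add_dist hconn hx hzq hxz.le
  have h₃ := hG.dist_add_dist hconn hyq hzq (hyx.trans hxz).le
  rcases q.dist_eq_succ_of_mem_edges hq he with h | h
  · have h₄ := hG.dist_add_dist hconn hx' hzq (by omega)
    exact hG.mem_edges_of_between hconn p hp hadj hyp hzp (by omega)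
  · have h₄ := hG.dist_add_dist hconn hyq hx' (by omega)
    rw [Sym2.eq_swap]
    exact hG.mem_edges_of_between hconn p hp hadj.symm hyp hzp (by omega)

/-- In a geodetic graph, no three distinct edges at a vertex belong to one shortest path. -/
theorem IsGeodetic.exists_notMem_edges (hG : G.IsGeodetic) (hconn : G.Connected)
    {u v x w₁ w₂ w₃ : V} (p : G.Walk u v) (hp : p.length = G.dist u v)
    (h₁₂ : w₁ ≠ w₂) (h₁₃ : w₁ ≠ w₃) (h₂₃ : w₂ ≠ w₃) (h₁ : s(x, w₁) ∈ p.edges) :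
    s(x, w₂) ∉ p.edges ∨ s(x, w₃) ∉ p.edges := by
  by_contra! ⟨h₂, h₃⟩
  have hne : ∀ {w w' : V}, s(x, w) ∈ p.edges → s(x, w') ∈ p.edges → w ≠ w' →
      G.dist u w ≠ G.dist u w' := fun h h' hw hd ↦ hw <|
    hG.eq_of_dist_eq hconn
      (p.dist_add_dist_of_mem_support hp (p.snd_mem_support_of_mem_edges h))
      (p.dist_add_dist_of_mem_support hp (p.snd_mem_support_of_mem_edges h')) hd
  have := hne h₁ h₂ h₁₂
  have := hne h₁ h₃ h₁₃
  have := hne h₂ h₃ h₂₃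
  have := p.dist_eq_succ_of_mem_edges hp h₁
  have := p.dist_eq_succ_of_mem_edges hp h₂
  have := p.dist_eq_succ_of_mem_edges hp h₃
  omega

/-- `x` is a vertex nearest to `a` among those lying both between `a` and `b` and between
`u` and `v`. -/
def IsFirstCommon (G : SimpleGraph V) (a b u v x : V) : Prop :=
  G.dist a x + G.dist x b = G.dist a b ∧ G.dist u x + G.dist x v = G.dist u v ∧
    ∀ y, G.dist a y + G.dist y b = G.dist a b → G.dist u y + G.dist y v = G.dist u v →
      G.dist a x ≤ G.dist a y

theorem IsGeodetic.isFirstCommon_unique (hG : G.IsGeodetic) (hconn : G.Connected)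
    {a b u v x y : V} (hx : G.IsFirstCommon a b u v x) (hy : G.IsFirstCommon a b u v y) :
    x = y :=
  hG.eq_of_dist_eq hconn hx.1 hy.1
    (le_antisymm (hx.2.2 y hy.1 hy.2.1) (hy.2.2 x hx.1 hx.2.1))

/-- In a geodetic graph, a vertex where the shortest path `q` leaves the shortest path `p` is the
first or the last vertex of `q` on `p`. -/
theorem IsGeodetic.isFirstCommon_or (hG : G.IsGeodetic) (hconn : G.Connected)
    {u v a b x w : V} (p : G.Walk u v) (hp : p.length = G.dist u v) (hx : x ∈ p.support)
    (q : G.Walk a b) (hq : q.length = G.dist a b)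
    (hwq : s(x, w) ∈ q.edges) (hwp : s(x, w) ∉ p.edges) :
    G.IsFirstCommon a b u v x ∨ G.IsFirstCommon b a u v x := by
  have hxp := p.dist_add_dist_of_mem_support hp hx
  have hxq := q.dist_add_dist_of_mem_support hq (q.fst_mem_support_of_mem_edges hwq)
  by_contra! ⟨h₁, h₂⟩
  have hswap : ∀ t, G.dist b t + G.dist t a = G.dist a t + G.dist t b := fun t ↦ by
    rw [G.dist_comm (u := b), G.dist_comm (u := t) (v := a), add_comm]
  have hba := G.dist_comm (u := b) (v := a)
  simp only [IsFirstCommon, not_and, not_forall, not_le] at h₁ h₂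
  obtain ⟨y, hyq, hyp, hyx⟩ := h₁ hxq hxp
  obtain ⟨z, hzq, hzp, hzx⟩ := h₂ (by rw [hswap]; omega) hxp
  rw [hswap, hba] at hzq
  rw [G.dist_comm (u := b), G.dist_comm (u := b)] at hzx
  exact hwp (hG.mem_edges_of_mem_edges hconn p hp q hq hwq hyp hyq hzp hzq hyx (by omega))

end SimpleGraph

/-- In a connected graph with unique shortest paths, the union of the chosen
shortest paths between the `k` terminals contains at most `k⁴` vertices of
degree at least 3. -/
theorem union_of_terminal_shortest_paths_few_branching_vertices
    {V : Type*} [Fintype V] (G : SimpleGraph V) (hconn : G.Connected)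
    (huniq : ∀ (u v : V) (p q : G.Walk u v), p.IsPath → q.IsPath →
      p.length = G.dist u v → q.length = G.dist u v → p = q)
    (hrev : ∀ (u v : V) (p : G.Walk u v) (q : G.Walk v u),
      p.IsPath → p.length = G.dist u v →
      q.IsPath → q.length = G.dist v u → q = p.reverse)
    (R : Finset V) (k : ℕ) (hk : 2 ≤ k) (hR : R.card = k)
    (p : ∀ u v : V, G.Walk u v)
    (hp : ∀ u v : V, u ∈ R → v ∈ R → u ≠ v →
      (p u v).IsPath ∧ (p u v).length = G.dist u v) :
    {x : V | 3 ≤ ((SimpleGraph.fromEdgeSet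
        {e : Sym2 V | ∃ u v : V, u ∈ R ∧ v ∈ R ∧ u ≠ v ∧ e ∈ (p u v).edges}
      ).neighborSet x).ncard}.ncard ≤ k ^ 4 := by
  classical
  have hG : G.IsGeodetic := huniq
  have := hconn.nonempty
  have hF : ∀ t : V × V × V × V, ∃ y, ∀ x,
      G.IsFirstCommon t.1 t.2.1 t.2.2.1 t.2.2.2 x → y = x := by
    intro t
    by_cases h : ∃ y, G.IsFirstCommon t.1 t.2.1 t.2.2.1 t.2.2.2 y
    · exact h.imp fun y hy x hx ↦ hG.isFirstCommon_unique hconn hy hx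
    · exact ⟨Classical.arbitrary V, fun x hx ↦ (h ⟨x, hx⟩).elim⟩
  choose F hF using hF
  have hsub : {x : V | 3 ≤ ((SimpleGraph.fromEdgeSet
        {e : Sym2 V | ∃ u v : V, u ∈ R ∧ v ∈ R ∧ u ≠ v ∧ e ∈ (p u v).edges}
      ).neighborSet x).ncard} ⊆ ((R ×ˢ R ×ˢ R ×ˢ R).image F : Finset V) := by
    intro x hx
    obtain ⟨w₁, w₂, w₃, hw₁, hw₂, hw₃, h₁₂, h₁₃, h₂₃⟩ :=
      (Set.two_lt_ncard_iff (Set.toFinite _)).1 hx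
    simp only [SimpleGraph.mem_neighborSet, SimpleGraph.fromEdgeSet_adj, Set.mem_ofPred_eq]
      at hw₁ hw₂ hw₃
    obtain ⟨⟨u, v, hu, hv, huv, he₁⟩, -⟩ := hw₁
    have hlen := (hp u v hu hv huv).2
    have hleave : ∃ a b w, a ∈ R ∧ b ∈ R ∧ a ≠ b ∧
        s(x, w) ∈ (p a b).edges ∧ s(x, w) ∉ (p u v).edges := by
      rcases hG.exists_notMem_edges hconn (p u v) hlen h₁₂ h₁₃ h₂₃ he₁ with h | h
      · obtain ⟨⟨a, b, ha, hb, hab, he⟩, -⟩ := hw₂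
        exact ⟨a, b, w₂, ha, hb, hab, he, h⟩
      · obtain ⟨⟨a, b, ha, hb, hab, he⟩, -⟩ := hw₃
        exact ⟨a, b, w₃, ha, hb, hab, he, h⟩
    obtain ⟨a, b, w, ha, hb, hab, hwq, hwp⟩ := hleave
    rw [Finset.mem_coe, Finset.mem_image]
    rcases hG.isFirstCommon_or hconn (p u v) hlen
      ((p u v).fst_mem_support_of_mem_edges he₁) (p a b) (hp a b ha hb hab).2 hwq hwp with h | h
    · exact ⟨(a, b, u, v), by simp [ha, hb, hu, hv], hF (a, b, u, v) x h⟩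
    · exact ⟨(b, a, u, v), by simp [ha, hb, hu, hv], hF (b, a, u, v) x h⟩
  calc _ ≤ ((R ×ˢ R ×ˢ R ×ˢ R).image F : Set V).ncard :=
        Set.ncard_le_ncard hsub (Set.toFinite _)
    _ ≤ (R ×ˢ R ×ˢ R ×ˢ R).card := by
        rw [Set.ncard_coe_finset]
        exact Finset.card_image_le
    _ = k ^ 4 := by
        simp only [Finset.card_product, hR]
        ring
end

section
/- Let k ≥ 2 be an even integer. Consider the grid graph G_k with vertex set {0,…,k−1} × {0,…,k−1}, where (x,y) and (x',y') are adjacent iff |x−x'| + |y−y'| = 1; the weight of a horizontal edge {(x,y),(x+1,y)} is 1 and the weight of a vertical edge {(x,y),(x,y+1)} is 1 + 1/(2^{x²}·k); the cost of a walk is the sum of the weights of its edges, counted with multiplicity. Then for all integers y, x with 0 ≤ y ≤ k/2 − 1 and k/2 ≤ x ≤ k − 1, the real number 2x − y + (x − y)/(2^{x²}·k) is the least element of the set of costs of walks in G_k from (0,y) to (x,x): some walk from (0,y) to (x,x) has exactly this cost, and every walk from (0,y) to (x,x) has cost at least this value. -/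
/-- The `k × k` grid graph. -/
abbrev gridGraph (k : ℕ) : SimpleGraph (Fin k × Fin k) :=
  SimpleGraph.fromRel (fun a b : Fin k × Fin k =>
    |(a.1 : ℤ) - (b.1 : ℤ)| + |(a.2 : ℤ) - (b.2 : ℤ)| = 1)

/-- The weight of a grid step: `1` if horizontal, `1 + 1/(2^(a²)·k)` if vertical in column `a`. -/
noncomputable abbrev gridWeight (k : ℕ) (u v : Fin k × Fin k) : ℝ :=
  if u.2 = v.2 then (1 : ℝ) else 1 + 1 / (2 ^ ((min u.1.val v.1.val) ^ 2) * k)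

/-- The total weight of the edges of a walk in the grid, with multiplicity. -/
noncomputable abbrev gridCost {k : ℕ} {u v : Fin k × Fin k} (p : (gridGraph k).Walk u v) : ℝ :=
  (p.darts.map (fun d => gridWeight k d.toProd.1 d.toProd.2)).sum

theorem gridGraph_adj_cases {k : ℕ} {u v : Fin k × Fin k} (h : (gridGraph k).Adj u v) :
    (u.2 = v.2 ∧ (u.1.val + 1 = v.1.val ∨ v.1.val + 1 = u.1.val)) ∨
      (u.1 = v.1 ∧ (u.2.val + 1 = v.2.val ∨ v.2.val + 1 = u.2.val)) := by
  rw [SimpleGraph.fromRel_adj] at h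
  simp only [Fin.ext_iff]
  rcases abs_cases ((u.1 : ℤ) - v.1) with h1 | h1 <;>
    rcases abs_cases ((u.2 : ℤ) - v.2) with h2 | h2 <;>
    rw [abs_sub_comm (v.1 : ℤ), abs_sub_comm (v.2 : ℤ)] at h <;>
    omega

theorem gridGraph_adj_right {k a b : ℕ} (ha : a + 1 < k) (hb : b < k) :
    (gridGraph k).Adj (⟨a, by omega⟩, ⟨b, hb⟩) (⟨a + 1, ha⟩, ⟨b, hb⟩) := by
  rw [SimpleGraph.fromRel_adj]
  simp

theorem gridGraph_adj_up {k a b : ℕ} (ha : a < k) (hb : b + 1 < k) :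
    (gridGraph k).Adj (⟨a, ha⟩, ⟨b, by omega⟩) (⟨a, ha⟩, ⟨b + 1, hb⟩) := by
  rw [SimpleGraph.fromRel_adj]
  simp

theorem exists_vertical_walk {k a : ℕ} (ha : a < k) (n b : ℕ) (hb : b + n < k) :
    ∃ p : (gridGraph k).Walk (⟨a, ha⟩, ⟨b, by omega⟩) (⟨a, ha⟩, ⟨b + n, hb⟩),
      gridCost p = n * (1 + 1 / (2 ^ (a ^ 2) * k)) := by
  induction n with
  | zero => exact ⟨.nil, by simp [gridCost]⟩
  | succ n ih =>
    obtain ⟨p, hp⟩ := ih (by omega)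
    refine ⟨p.concat (gridGraph_adj_up ha hb), ?_⟩
    simp only [gridCost, SimpleGraph.Walk.darts_concat, List.concat_eq_append, List.map_append,
      List.sum_append] at hp ⊢
    rw [hp]
    simp [gridWeight]
    ring

theorem exists_horizontal_walk {k b : ℕ} (hb : b < k) (n a : ℕ) (ha : a + n < k) :
    ∃ p : (gridGraph k).Walk (⟨a, by omega⟩, ⟨b, hb⟩) (⟨a + n, ha⟩, ⟨b, hb⟩),
      gridCost p = n := by
  induction n with
  | zero => exact ⟨.nil, by simp [gridCost]⟩
  | succ n ih =>
    obtain ⟨p, hp⟩ := ih (by omega)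
    refine ⟨p.concat (gridGraph_adj_right ha hb), ?_⟩
    simp only [gridCost, SimpleGraph.Walk.darts_concat, List.concat_eq_append, List.map_append,
      List.sum_append] at hp ⊢
    rw [hp]
    simp [gridWeight]

/-- A lower bound on the cost of reaching `(x, x)`, in which the perturbation of the vertical
weights is only charged to the left of column `x`. -/
noncomputable def gridPotential (k x : ℕ) (u : Fin k × Fin k) : ℝ :=
  |(x : ℝ) - u.1.val| + |(x : ℝ) - u.2.val| +
    if u.1.val ≤ x then 1 / (2 ^ (x ^ 2) * k) * |(x : ℝ) - u.2.val| else 0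

theorem gridPotential_le_of_adj {k x : ℕ} (hx : x < k) {u v : Fin k × Fin k}
    (h : (gridGraph k).Adj u v) :
    gridPotential k x u ≤ gridWeight k u v + gridPotential k x v := by
  have hk : (0 : ℝ) < k := by exact_mod_cast (by omega : 0 < k)
  obtain ⟨⟨a, ha⟩, ⟨b, hb⟩⟩ := u
  obtain ⟨⟨c, hc⟩, ⟨d, hd⟩⟩ := v
  have hcases := gridGraph_adj_cases h
  simp only [Fin.mk.injEq] at hcases
  simp only [gridPotential, gridWeight, Fin.mk.injEq]
  have hε : (0 : ℝ) ≤ 1 / (2 ^ (x ^ 2) * k) := by positivity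
  rcases hcases with ⟨rfl, hac⟩ | ⟨rfl, hbd⟩
  · have htri : |(x : ℝ) - a| ≤ 1 + |(x : ℝ) - c| := by
      have h1 : |(c : ℝ) - a| = 1 := by
        rcases hac with rfl | rfl <;> simp
      have h2 := abs_add_le ((x : ℝ) - c) (c - a)
      rw [sub_add_sub_cancel] at h2
      linarith
    have hnn : 0 ≤ 1 / (2 ^ (x ^ 2) * (k : ℝ)) * |(x : ℝ) - b| := by positivity
    rw [if_pos rfl]
    split_ifs with h1 h2 h2
    · linarith
    · obtain rfl : a = x := by omega
      obtain rfl : c = a + 1 := by omega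
      have hdist : |(a : ℝ) - b| ≤ k := by
        have : (a : ℝ) ≤ k := by exact_mod_cast hx.le
        have : (b : ℝ) ≤ k := by exact_mod_cast hb.le
        have : (0 : ℝ) ≤ a := by positivity
        have : (0 : ℝ) ≤ b := by positivity
        rw [abs_le]
        constructor <;> linarith
      have hsmall : 1 / (2 ^ (a ^ 2) * (k : ℝ)) * |(a : ℝ) - b| ≤ 1 := by
        rw [one_div_mul_eq_div, div_le_one (by positivity)]
        have : (1 : ℝ) ≤ 2 ^ (a ^ 2) := one_le_pow₀ (by norm_num)
        nlinarith
      simp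
      simp at hsmall
      linarith
    · linarith
    · linarith
  · have htri : |(x : ℝ) - b| ≤ 1 + |(x : ℝ) - d| := by
      have h1 : |(d : ℝ) - b| = 1 := by
        rcases hbd with rfl | rfl <;> simp
      have h2 := abs_add_le ((x : ℝ) - d) (d - b)
      rw [sub_add_sub_cancel] at h2
      linarith
    rw [if_neg (show ¬b = d by omega), min_self]
    split_ifs with h1
    · have hle : 1 / (2 ^ (x ^ 2) * (k : ℝ)) ≤ 1 / (2 ^ (a ^ 2) * (k : ℝ)) := by
        gcongr
        norm_num
      nlinarith
    · have : (0 : ℝ) ≤ 1 / (2 ^ (a ^ 2) * k) := by positivity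
      linarith

theorem gridPotential_le_cost {k x : ℕ} (hx : x < k) {u v : Fin k × Fin k}
    (p : (gridGraph k).Walk u v) : gridPotential k x u ≤ gridCost p + gridPotential k x v := by
  induction p with
  | nil => simp [gridCost]
  | cons h p ih =>
    have hstep := gridPotential_le_of_adj hx h
    simp only [gridCost, SimpleGraph.Walk.darts_cons, List.map_cons, List.sum_cons] at ih ⊢
    linarith


/-- Equation (1) of the paper: in the weighted `k × k` grid where horizontal
edges have weight `1` and vertical edges in column `x` have weight
`1 + 1/(2^(x²)·k)`, the minimum cost of a walk from `(0, y)` to `(x, x)`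
(for `0 ≤ y ≤ k/2 - 1` and `k/2 ≤ x ≤ k - 1`) is exactly
`2x - y + (x - y)/(2^(x²)·k)`. -/
theorem grid_distance_formula
    (k : ℕ) (hk : 2 ≤ k) (hke : Even k)
    (y x : ℕ) (hy : y ≤ k / 2 - 1) (hx1 : k / 2 ≤ x) (hx2 : x ≤ k - 1) :
    IsLeast
      {c : ℝ |
        ∃ pw : (SimpleGraph.fromRel (fun a b : Fin k × Fin k =>
            |(a.1 : ℤ) - (b.1 : ℤ)| + |(a.2 : ℤ) - (b.2 : ℤ)| = 1)).Walk
          (⟨0, by omega⟩, ⟨y, by omega⟩) (⟨x, by omega⟩, ⟨x, by omega⟩),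
        (pw.darts.map (fun d =>
          if d.toProd.1.2 = d.toProd.2.2 then (1 : ℝ)
          else 1 + 1 / (2 ^ ((min d.toProd.1.1.val d.toProd.2.1.val) ^ 2) * k))).sum = c}
      (2 * (x : ℝ) - (y : ℝ) + ((x : ℝ) - (y : ℝ)) / (2 ^ (x ^ 2) * k)) := by
  have hxk : x < k := by omega
  have hyx : y ≤ x := by omega
  constructor
  · obtain ⟨p, hp⟩ := exists_horizontal_walk (show y < k by omega) x 0 (by omega)
    obtain ⟨q, hq⟩ := exists_vertical_walk hxk (x - y) y (by omega)
    refine ⟨(p.append (q.copy (by simp) rfl)).copy rfl (by ext <;> simp [hyx]), ?_⟩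
    simp only [gridCost, gridWeight] at hp hq
    simp only [SimpleGraph.Walk.darts_copy, SimpleGraph.Walk.darts_append, List.map_append,
      List.sum_append]
    rw [hp, hq]
    push_cast [hyx]
    ring
  · rintro c ⟨p, rfl⟩
    have hp := gridPotential_le_cost hxk p
    have hyx' : (0 : ℝ) ≤ x - y := sub_nonneg.2 (by exact_mod_cast hyx)
    simp only [gridPotential, Nat.cast_zero, sub_zero, Nat.cast_nonneg, abs_of_nonneg, hyx',
      zero_le, if_true, sub_self, le_refl, mul_zero, add_zero] at hp
    refine le_trans (le_of_eq ?_) hp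
    ring
end

section
/- Let k ≥ 2 and s ≥ 2 be natural numbers with s ≤ k. Let x : Fin s → ℕ and y : Fin s → ℕ be injective functions such that k ≤ 2·x(i) and y(i) < k for all i. Then, with indices taken cyclically modulo s, ∑_{i=0}^{s−1} ( (y(i) : ℚ) − y(i+1) ) / 2^{x(i)²} ≠ 0. -/
/-- Two squares `M ^ 2`, `m ^ 2` with `m < M` differ by at least `2 * M - 1`. -/
lemma two_mul_sub_one_le_sq_sub_sq {m M : ℕ} (h : m < M) : 2 * M - 1 ≤ M ^ 2 - m ^ 2 := by
  obtain ⟨d, rfl⟩ := Nat.exists_eq_add_of_lt h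
  apply Nat.le_sub_of_add_le
  rw [tsub_add_eq_add_tsub (by omega), tsub_le_iff_right]
  nlinarith [Nat.zero_le (m * d), Nat.zero_le (d ^ 2)]

/-- The numbers `1 / 2 ^ (x i) ^ 2` admit no vanishing combination with nonzero integer
coefficients that are small compared with every `x i`. -/
lemma sum_div_two_pow_sq_ne_zero {ι : Type*} [Fintype ι] [Nonempty ι] {x : ι → ℕ}
    (hx : Function.Injective x) {c : ι → ℤ} (hc : ∀ i, c i ≠ 0) (hcx : ∀ i, |c i| < 2 * x i) :
    ∑ i, (c i : ℚ) / 2 ^ (x i) ^ 2 ≠ 0 := by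
  classical
  intro h
  obtain ⟨m, hm⟩ := Finite.exists_max x
  have hsum : ∑ i, c i * 2 ^ (x m ^ 2 - x i ^ 2) = 0 := by
    have h' := congrArg (· * (2 : ℚ) ^ x m ^ 2) h
    simp only [Finset.sum_mul, zero_mul] at h'
    rw [← Int.cast_inj (α := ℚ), Int.cast_zero, ← h', Int.cast_sum]
    refine Finset.sum_congr rfl fun i _ => ?_
    push_cast
    rw [pow_sub₀ _ two_ne_zero (Nat.pow_le_pow_left (hm i) 2)]
    ring
  rw [← Finset.add_sum_erase _ _ (Finset.mem_univ m), Nat.sub_self, pow_zero, mul_one] at hsum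
  have hdvd : (2 : ℤ) ^ (2 * x m - 1) ∣ c m := by
    rw [eq_neg_of_add_eq_zero_left hsum, dvd_neg]
    refine Finset.dvd_sum fun i hi => Dvd.dvd.mul_left (pow_dvd_pow 2 ?_) _
    exact two_mul_sub_one_le_sq_sub_sq
      (lt_of_le_of_ne (hm i) (hx.ne (Finset.ne_of_mem_erase hi)))
  have hlt : 2 * x m - 1 < 2 ^ (2 * x m - 1) := Nat.lt_two_pow_self
  have hle : (2 * x m : ℤ) ≤ 2 ^ (2 * x m - 1) := by
    exact_mod_cast (by omega : 2 * x m ≤ 2 ^ (2 * x m - 1))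
  exact hc m (Int.eq_zero_of_abs_lt_dvd hdvd ((hcx m).trans_le hle))

/-- The arithmetic core of Lemma 3 of the paper: for injective `x, y : Fin s → ℕ`
with `k ≤ 2·x i` and `y i < k` for all `i`, the cyclic sum
`∑ i, (y i - y (i+1)) / 2^(x i)²` is nonzero. -/
theorem cyclic_sum_ne_zero
    (k s : ℕ) [NeZero s] (hk : 2 ≤ k) (hs : 2 ≤ s) (hsk : s ≤ k)
    (x y : Fin s → ℕ) (hx : Function.Injective x) (hy : Function.Injective y)
    (hkx : ∀ i : Fin s, k ≤ 2 * x i) (hyk : ∀ i : Fin s, y i < k) :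
    ∑ i : Fin s, ((y i : ℚ) - (y (i + 1) : ℚ)) / 2 ^ (x i) ^ 2 ≠ 0 := by
  have hne : ∀ i : Fin s, i ≠ i + 1 := fun i h => by
    have : (1 : Fin s) = 0 := by simpa using h.symm
    simp [Fin.ext_iff, Nat.mod_eq_of_lt hs] at this
  have key := sum_div_two_pow_sq_ne_zero hx (c := fun i => (y i : ℤ) - y (i + 1))
    (fun i h => hne i (hy (by omega)))
    (fun i => by
      have h₁ := hyk i
      have h₂ := hyk (i + 1)
      have h₃ := hkx i
      rw [abs_lt]
      omega)
  simpa using key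
end

section
/- Let k ≥ 2 be an even integer. Let Q₁ ⊆ {0, …, k/2 − 1} and Q₂ ⊆ {k/2, …, k − 1} be finite sets of natural numbers, and let a : ℕ → ℝ and b : ℕ → ℝ be arbitrary functions. Define D(y,x) = 2x − y + (x − y)/(2^{x²}·k). Then the number of pairs (y,x) ∈ Q₁ × Q₂ satisfying a(y) + b(x) = D(y,x) is at most |Q₁| + |Q₂|. -/
/-- If the values of `f` on each finite set `N x` are separated by more than `w (x + 1)`, and spread
little enough that two further steps of size `w (x + 1)` stay within `w x`, then the bipartite
incidence graph of the `N x` is a forest; `r` sends each `y` to a label of its component. -/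
theorem exists_labelling_of_separated (Q S : Finset ℕ) (N : ℕ → Finset ℕ) (f w : ℕ → ℝ)
    (hN : ∀ x ∈ S, N x ⊆ Q) (hw : Antitone w) (hw0 : ∀ x, 0 ≤ w x)
    (hsep : ∀ x ∈ S, ∀ y ∈ N x, ∀ z ∈ N x, y ≠ z → w (x + 1) < |f y - f z|)
    (hdiam : ∀ x ∈ S, ∀ y ∈ N x, ∀ z ∈ N x, |f y - f z| + 2 * w (x + 1) ≤ w x) :
    ∃ r : ℕ → ℕ, (∀ m, (∀ x ∈ S, m ≤ x) →
        ∀ y ∈ Q, ∀ z ∈ Q, r y = r z → |f y - f z| ≤ w m) ∧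
      ∑ x ∈ S, (N x).card + (Q.image r).card ≤ Q.card + S.card := by
  induction S using Finset.induction_on_min with
  | empty =>
    refine ⟨id, fun m _ y _ z _ h => ?_, by simp⟩
    obtain rfl : y = z := h
    simpa using hw0 m
  | insert x S hx ih =>
    obtain ⟨r, hr, hcard⟩ := ih (fun s hs => hN s (Finset.mem_insert_of_mem hs))
      (fun s hs => hsep s (Finset.mem_insert_of_mem hs))
      (fun s hs => hdiam s (Finset.mem_insert_of_mem hs))
    have hxS : x ∉ S := fun h => lt_irrefl _ (hx x h)
    have hNx := hN x (Finset.mem_insert_self x S)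
    have hsep := hsep x (Finset.mem_insert_self x S)
    have hdiam := hdiam x (Finset.mem_insert_self x S)
    have hr' := hr (x + 1) (fun s hs => hx s hs)
    rw [Finset.sum_insert hxS, Finset.card_insert_of_notMem hxS]
    rcases (N x).eq_empty_or_nonempty with h_empty | ⟨y₀, hy₀⟩
    · refine ⟨r, fun m hm => hr m fun s hs => hm s (Finset.mem_insert_of_mem hs), ?_⟩
      rw [h_empty, Finset.card_empty]
      omega
    have h_inj : Set.InjOn r (N x) := by
      intro y hy z hz hyz
      by_contra hne
      exact absurd (hr' y (hNx hy) z (hNx hz) hyz) (not_le.2 (hsep y hy z hz hne))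
    refine ⟨fun y => if r y ∈ (N x).image r then r y₀ else r y, ?_, ?_⟩
    · intro m hm y hy z hz hyz
      refine le_trans ?_ (hw (hm x (Finset.mem_insert_self x S)))
      have h_mem₀ : r y₀ ∈ (N x).image r := Finset.mem_image_of_mem r hy₀
      have h₀ := hdiam y₀ hy₀ y₀ hy₀
      rw [sub_self, abs_zero] at h₀
      have h_nonneg := hw0 (x + 1)
      by_cases h₁ : r y ∈ (N x).image r <;> by_cases h₂ : r z ∈ (N x).image r
      · obtain ⟨u, hu, huy⟩ := Finset.mem_image.1 h₁
        obtain ⟨v, hv, hvz⟩ := Finset.mem_image.1 h₂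
        have h₃ := hr' y hy u (hNx hu) huy.symm
        have h₄ := hr' v (hNx hv) z hz hvz
        have h₅ := hdiam u hu v hv
        have h₆ := abs_sub_le (f y) (f u) (f z)
        have h₇ := abs_sub_le (f u) (f v) (f z)
        linarith
      · simp only [if_pos h₁, if_neg h₂] at hyz
        exact absurd (hyz ▸ h_mem₀) h₂
      · simp only [if_neg h₁, if_pos h₂] at hyz
        exact absurd (hyz ▸ h_mem₀) h₁
      · simp only [if_neg h₁, if_neg h₂] at hyz
        have h₃ := hr' y hy z hz hyz
        linarith
    · have h_sub : Q.image (fun y => if r y ∈ (N x).image r then r y₀ else r y) ⊆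
          insert (r y₀) (Q.image r \ (N x).image r) := by
        intro t ht
        obtain ⟨y, hy, rfl⟩ := Finset.mem_image.1 ht
        by_cases h : r y ∈ (N x).image r
        · simp only [if_pos h, Finset.mem_insert_self]
        · simp only [if_neg h]
          exact Finset.mem_insert_of_mem
            (Finset.mem_sdiff.2 ⟨Finset.mem_image_of_mem r hy, h⟩)
      have h₁ := (Finset.card_le_card h_sub).trans (Finset.card_insert_le _ _)
      have h₂ := Finset.card_sdiff_add_card_eq_card (Finset.image_subset_image (f := r) hNx)
      rw [Finset.card_image_of_injOn h_inj] at h₂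
      omega

/-- Abstract form of Lemma 3 of the paper: for any functions `a`, `b`, the number
of pairs `(y, x) ∈ Q₁ × Q₂` with `a y + b x = D(y,x)`, where
`D(y,x) = 2x - y + (x - y)/(2^(x²)·k)` is the grid distance, is at most
`|Q₁| + |Q₂|`. -/
theorem pairs_through_separator_vertex_le
    (k : ℕ) (hk : 2 ≤ k) (hke : Even k)
    (Q₁ Q₂ : Finset ℕ)
    (hQ₁ : ∀ y ∈ Q₁, y ≤ k / 2 - 1)
    (hQ₂ : ∀ x ∈ Q₂, k / 2 ≤ x ∧ x ≤ k - 1)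
    (a b : ℕ → ℝ) :
    {q : ℕ × ℕ | q.1 ∈ Q₁ ∧ q.2 ∈ Q₂ ∧
        a q.1 + b q.2 =
          2 * (q.2 : ℝ) - (q.1 : ℝ) +
            ((q.2 : ℝ) - (q.1 : ℝ)) / (2 ^ (q.2 ^ 2) * k)}.ncard
      ≤ Q₁.card + Q₂.card := by
  classical
  set N : ℕ → Finset ℕ := fun x => Q₁.filter fun y => a y + b x =
    2 * (x : ℝ) - (y : ℝ) + ((x : ℝ) - (y : ℝ)) / (2 ^ (x ^ 2) * k) with hN
  have hk0 : (0 : ℝ) < k := by exact_mod_cast (by omega : 0 < k)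
  have h_abs : ∀ x, ∀ y ∈ N x, ∀ z ∈ N x,
      |(a y + y) - (a z + z)| = |(y : ℝ) - z| / k * (1 / 2 ^ (x ^ 2)) := by
    intro x y hy z hz
    have h₁ := (Finset.mem_filter.1 hy).2
    have h₂ := (Finset.mem_filter.1 hz).2
    have h₃ : (a y + y) - (a z + z) = -(((y : ℝ) - z) / k * (1 / 2 ^ (x ^ 2))) := by
      have h₄ : (a y + y) - (a z + z) = ((x : ℝ) - y) / (2 ^ (x ^ 2) * k)
          - ((x : ℝ) - z) / (2 ^ (x ^ 2) * k) := by linarith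
      rw [h₄]
      field_simp
      ring
    rw [h₃, abs_neg, abs_mul, abs_div, abs_of_pos hk0,
      abs_of_pos (by positivity : (0 : ℝ) < 1 / 2 ^ (x ^ 2))]
  have h_pow : ∀ x : ℕ, (1 : ℝ) / 2 ^ ((x + 1) ^ 2) = 1 / 2 ^ (2 * x + 1) * (1 / 2 ^ (x ^ 2)) := by
    intro x
    rw [show (x + 1) ^ 2 = 2 * x + 1 + x ^ 2 by ring, pow_add, one_div_mul_one_div]
  obtain ⟨r, -, hr⟩ := exists_labelling_of_separated Q₁ Q₂ N (fun y => a y + y)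
    (fun x => 1 / 2 ^ (x ^ 2)) (fun x _ => Finset.filter_subset _ _)
    (fun m n h => one_div_le_one_div_of_le (by positivity)
      (pow_le_pow_right₀ one_le_two (Nat.pow_le_pow_left h 2)))
    (fun x => by positivity)
    (by
      intro x hx y hy z hz hne
      simp only [h_abs x y hy z hz, h_pow]
      refine mul_lt_mul_of_pos_right ?_ (by positivity)
      have h₁ : (1 : ℝ) ≤ |(y : ℝ) - z| := by
        have h : (1 : ℤ) ≤ |(y : ℤ) - z| := Int.one_le_abs (by omega)
        exact_mod_cast h
      have h₂ : (k : ℝ) < 2 ^ (2 * x + 1) := by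
        have h : k < 2 ^ (2 * x + 1) :=
          lt_of_le_of_lt (by have := (hQ₂ x hx).1; omega) Nat.lt_two_pow_self
        exact_mod_cast h
      exact (one_div_lt_one_div_of_lt hk0 h₂).trans_le (by gcongr))
    (by
      intro x hx y hy z hz
      simp only [h_abs x y hy z hz, h_pow]
      have h₁ : |(y : ℝ) - z| / k ≤ 1 / 2 := by
        have h₂ : 2 * y ≤ k := by
          have := hQ₁ y (Finset.mem_filter.1 hy).1
          omega
        have h₃ : 2 * z ≤ k := by
          have := hQ₁ z (Finset.mem_filter.1 hz).1
          omega
        have h₄ : 2 * (y : ℝ) ≤ k := by exact_mod_cast h₂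
        have h₅ : 2 * (z : ℝ) ≤ k := by exact_mod_cast h₃
        have h₆ : (0 : ℝ) ≤ y := y.cast_nonneg
        have h₇ : (0 : ℝ) ≤ z := z.cast_nonneg
        rw [div_le_iff₀ hk0, abs_le]
        constructor <;> linarith
      have h₂ : (1 : ℝ) / 2 ^ (2 * x + 1) ≤ 1 / 2 ^ 2 :=
        one_div_le_one_div_of_le (by positivity)
          (pow_le_pow_right₀ one_le_two (by have := (hQ₂ x hx).1; omega))
      have h₃ : (0 : ℝ) < 1 / 2 ^ (x ^ 2) := by positivity
      nlinarith)
  have h_eq : {q : ℕ × ℕ | q.1 ∈ Q₁ ∧ q.2 ∈ Q₂ ∧ a q.1 + b q.2 = 2 * (q.2 : ℝ) - (q.1 : ℝ) +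
      ((q.2 : ℝ) - (q.1 : ℝ)) / (2 ^ (q.2 ^ 2) * k)} =
      (fun p : (_ : ℕ) × ℕ => (p.2, p.1)) '' (Q₂.sigma N : Set ((_ : ℕ) × ℕ)) := by
    ext ⟨y, x⟩
    simp only [hN, Set.mem_ofPred_eq, Set.mem_image, Finset.mem_coe, Finset.mem_sigma,
      Finset.mem_filter, Sigma.exists, Prod.mk.injEq]
    constructor
    · rintro ⟨h₁, h₂, h₃⟩
      exact ⟨x, y, ⟨h₂, h₁, h₃⟩, rfl, rfl⟩
    · rintro ⟨_, _, ⟨h₂, h₁, h₃⟩, rfl, rfl⟩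
      exact ⟨h₁, h₂, h₃⟩
  rw [h_eq]
  refine (Set.ncard_image_le (Finset.finite_toSet _)).trans ?_
  rw [Set.ncard_coe_finset, Finset.card_sigma]
  omega
end

section
/- Let k be a positive integer divisible by 40. Let Q₁ ⊆ {0, …, k/2 − 1} and Q₂ ⊆ {k/2, …, k − 1} be finite sets of natural numbers with |Q₁| = k/5 and |Q₂| = k/8. Let S be a finite index set with |S| ≤ 3k/40, and for each v ∈ S let a_v : ℕ → ℝ and b_v : ℕ → ℝ be arbitrary functions. Define D(y,x) = 2x − y + (x − y)/(2^{x²}·k). Then there exists a pair (y,x) ∈ Q₁ × Q₂ such that a_v(y) + b_v(x) ≠ D(y,x) for every v ∈ S. -/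
open Finset in
/-- If a finite point set `Q` on the line contains `y`, and `z` lies at least `D` to the right of
`y`, then `Q` has a gap of length `D / #Q` starting between `y` and `z`. -/
lemma exists_gap_of_le_sub {α : Type*} [DecidableEq α] (Q : Finset α) (A : α → ℝ) {y z : α}
    (hy : y ∈ Q) {D : ℝ} (hD : 0 < D) (h : D ≤ A z - A y) :
    ∃ t, A y ≤ t ∧ t < A z ∧ ∀ u ∈ Q, t < A u → t + D / #Q < A u := by
  have hn : (0 : ℝ) < #Q := by exact_mod_cast card_pos.mpr ⟨y, hy⟩
  set δ : ℝ := D / #Q with hδ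
  have hδ0 : 0 < δ := by positivity
  have hDδ : #Q * δ = D := by rw [hδ]; field_simp
  by_contra! hcon
  have hpt : ∀ i ∈ range #Q, ∃ u ∈ Q, A y + i * δ < A u ∧ A u ≤ A y + i * δ + δ := by
    intro i hi
    have hi' : (i : ℝ) < #Q := by exact_mod_cast mem_range.mp hi
    refine hcon (A y + i * δ) (le_add_of_nonneg_right (by positivity)) ?_
    nlinarith
  have : Nonempty α := ⟨y⟩
  choose! f hfQ hf₁ hf₂ using hpt
  have hmaps : ∀ i ∈ range #Q, f i ∈ Q.erase y := by
    intro i hi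
    refine mem_erase.mpr ⟨fun he => ?_, hfQ i hi⟩
    have := hf₁ i hi
    rw [he] at this
    have : 0 ≤ (i : ℝ) * δ := by positivity
    linarith
  have key : ∀ i ∈ range #Q, ∀ j ∈ range #Q, f i = f j → i ≤ j := by
    intro i hi j hj he
    by_contra! hlt
    have hlt' : (j : ℝ) + 1 ≤ i := by exact_mod_cast hlt
    have h₁ := hf₁ i hi
    have h₂ := hf₂ j hj
    rw [he] at h₁
    nlinarith
  have hcard := card_le_card_of_injOn (s := range #Q) (t := Q.erase y) f hmaps
    (fun i hi j hj he => le_antisymm (key i hi j hj he) (key j hj i hi he.symm))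
  rw [card_range, card_erase_of_mem hy] at hcard
  have := card_pos.mpr ⟨y, hy⟩
  omega

open Finset in
/-- Sets of points on the line whose internal distances live at widely separated scales
form a forest-like hypergraph. -/
lemma sum_card_inter_sub_one_le_of_scales {α : Type*} [DecidableEq α] (A : α → ℝ)
    (X : Finset ℕ) (N : ℕ → Finset α) (w : ℕ → ℝ) (K : ℝ) (n : ℕ)
    (hw : ∀ x ∈ X, 0 < w x)
    (hN : ∀ x ∈ X, ∀ y ∈ N x, ∀ z ∈ N x, y ≠ z →
      w x ≤ |A y - A z| ∧ |A y - A z| ≤ K * w x)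
    (hsep : ∀ x ∈ X, ∀ x' ∈ X, x < x' → n * (K * w x') < w x)
    (Q : Finset α) (hQ : #Q ≤ n) :
    ∑ x ∈ X, (#(Q ∩ N x) - 1) ≤ #Q - 1 := by
  induction Q using Finset.strongInduction with
  | H Q ih =>
    by_cases hX : ∃ x, x ∈ X ∧ 1 < #(Q ∩ N x)
    · classical
      obtain ⟨hx₀, hc₀⟩ := Nat.find_spec hX
      have hmin : ∀ x ∈ X, 1 < #(Q ∩ N x) → Nat.find hX ≤ x :=
        fun x hx hc => Nat.find_min' hX ⟨hx, hc⟩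
      generalize Nat.find hX = x₀ at hx₀ hc₀ hmin
      have hyz : ∃ y ∈ Q ∩ N x₀, ∃ z ∈ Q ∩ N x₀, w x₀ ≤ A z - A y := by
        obtain ⟨y, hy, z, hz, hne⟩ := one_lt_card.mp hc₀
        have h := (hN x₀ hx₀ y (mem_inter.mp hy).2 z (mem_inter.mp hz).2 hne).1
        rcases le_abs.mp h with h | h
        · exact ⟨z, hz, y, hy, h⟩
        · exact ⟨y, hy, z, hz, by linarith⟩
      obtain ⟨y, hy, z, hz, hd⟩ := hyz
      have hyQ := (mem_inter.mp hy).1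
      have hzQ := (mem_inter.mp hz).1
      obtain ⟨t, hty, htz, hgap⟩ := exists_gap_of_le_sub Q A hyQ (hw x₀ hx₀) hd
      set L := Q.filter (fun u => A u ≤ t) with hL
      set R := Q.filter (fun u => ¬ A u ≤ t) with hR
      have hyL : y ∈ L := mem_filter.mpr ⟨hyQ, hty⟩
      have hzR : z ∈ R := mem_filter.mpr ⟨hzQ, not_le.mpr htz⟩
      have hLQ : L ⊂ Q := filter_ssubset.mpr ⟨z, hzQ, not_le.mpr htz⟩
      have hRQ : R ⊂ Q := filter_ssubset.mpr ⟨y, hyQ, not_not.mpr hty⟩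
      have hcardQ : #L + #R = #Q := card_filter_add_card_filter_not (s := Q) _
      have hLpos : 0 < #L := card_pos.mpr ⟨y, hyL⟩
      have hRpos : 0 < #R := card_pos.mpr ⟨z, hzR⟩
      have ihL := ih L hLQ (by omega)
      have ihR := ih R hRQ (by omega)
      have hsplit : ∀ x, #(L ∩ N x) + #(R ∩ N x) = #(Q ∩ N x) := by
        intro x
        rw [hL, hR, filter_inter, filter_inter]
        exact card_filter_add_card_filter_not (s := Q ∩ N x) _
      have hcross : ∀ x ∈ X, x ≠ x₀ → 1 < #(Q ∩ N x) → #(L ∩ N x) = 0 ∨ #(R ∩ N x) = 0 := by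
        intro x hx hne hc
        by_contra! hcon
        obtain ⟨u, hu⟩ := card_pos.mp (Nat.pos_of_ne_zero hcon.1)
        obtain ⟨v, hv⟩ := card_pos.mp (Nat.pos_of_ne_zero hcon.2)
        obtain ⟨huL, huN⟩ := mem_inter.mp hu
        obtain ⟨hvR, hvN⟩ := mem_inter.mp hv
        have hut := (mem_filter.mp huL).2
        obtain ⟨hvQ, hvt⟩ := mem_filter.mp hvR
        have hvg := hgap v hvQ (not_le.mp hvt)
        have huv : v ≠ u := by
          rintro rfl
          exact hvt hut
        have h₁ := (hN x hx v hvN u huN huv).2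
        have h₂ := hsep x₀ hx₀ x hx (lt_of_le_of_ne (hmin x hx hc) hne.symm)
        have h₃ := le_abs_self (A v - A u)
        have hQ0 : (0 : ℝ) < #Q := by exact_mod_cast card_pos.mpr ⟨y, hyQ⟩
        have hQn : (#Q : ℝ) ≤ n := by exact_mod_cast hQ
        have h₄ : w x₀ / #Q < K * w x := by linarith
        rw [div_lt_iff₀ hQ0] at h₄
        have h₅ : 0 ≤ K * w x := (abs_nonneg _).trans h₁
        nlinarith
      have hterm : ∀ x ∈ X, #(Q ∩ N x) - 1 ≤
          (#(L ∩ N x) - 1) + (#(R ∩ N x) - 1) + if x = x₀ then 1 else 0 := by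
        intro x hx
        have hs := hsplit x
        split_ifs with he
        · omega
        · have := hcross x hx he
          omega
      have hsum := sum_le_sum hterm
      rw [sum_add_distrib, sum_add_distrib, sum_ite_eq' X x₀, if_pos hx₀] at hsum
      omega
    · push Not at hX
      rw [sum_eq_zero fun x hx => Nat.sub_eq_zero_of_le (hX x hx)]
      exact Nat.zero_le _

lemma sq_mul_two_pow_sq_lt {k x x' : ℕ} (hk : Even k) (hx : k / 2 ≤ x) (hxx' : x < x') :
    k * k * 2 ^ (x ^ 2) < 2 ^ (x' ^ 2) := by
  obtain ⟨h, rfl⟩ := hk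
  have hh : h + h ≤ 2 ^ h := by
    rcases h with _ | h
    · simp
    · have := Nat.lt_two_pow_self (n := h)
      rw [pow_succ]
      omega
  calc (h + h) * (h + h) * 2 ^ (x ^ 2) ≤ 2 ^ h * 2 ^ h * 2 ^ (x ^ 2) := by gcongr
    _ = 2 ^ (h + h + x ^ 2) := by rw [pow_add, pow_add]
    _ < 2 ^ (x' ^ 2) := by
      apply Nat.pow_lt_pow_right (by norm_num)
      have : h ≤ x := by omega
      nlinarith

open Finset in
/-- A single separator vertex accounts for at most `#Q₁ + #Q₂` terminal pairs. -/
lemma sum_card_filter_add_eq_le {k : ℕ} (hk : 0 < k) (hk2 : Even k) (Q₁ Q₂ : Finset ℕ)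
    (hQ₁ : ∀ y ∈ Q₁, y < k) (hQ₂ : ∀ x ∈ Q₂, k / 2 ≤ x) (hc : #Q₁ ≤ k) (a b : ℕ → ℝ) :
    ∑ x ∈ Q₂, #{y ∈ Q₁ | a y + b x =
        2 * (x : ℝ) - (y : ℝ) + ((x : ℝ) - (y : ℝ)) / (2 ^ (x ^ 2) * k)} ≤ #Q₁ + #Q₂ := by
  set N : ℕ → Finset ℕ := fun x => {y ∈ Q₁ | a y + b x =
    2 * (x : ℝ) - (y : ℝ) + ((x : ℝ) - (y : ℝ)) / (2 ^ (x ^ 2) * k)}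
  change ∑ x ∈ Q₂, #(N x) ≤ _
  have hk' : (0 : ℝ) < k := by exact_mod_cast hk
  have hforest := sum_card_inter_sub_one_le_of_scales (fun y : ℕ => a y + y) Q₂ N
    (fun x => 1 / (2 ^ (x ^ 2) * k)) k k (fun x _ => by positivity) ?_ ?_ Q₁ hc
  · have hN : ∀ x ∈ Q₂, #(N x) ≤ (#(Q₁ ∩ N x) - 1) + 1 := by
      intro x _
      rw [inter_eq_right.mpr (show N x ⊆ Q₁ from filter_subset _ _)]
      omega
    have hsum := sum_le_sum hN
    rw [sum_add_distrib, sum_const, smul_eq_mul, mul_one] at hsum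
    omega
  · intro x _ y hy z hz hne
    obtain ⟨hyQ, hye⟩ := mem_filter.mp hy
    obtain ⟨hzQ, hze⟩ := mem_filter.mp hz
    have hw : (0 : ℝ) < 1 / (2 ^ (x ^ 2) * k) := by positivity
    have hdiff : a y + y - (a z + z) = ((z : ℝ) - y) * (1 / (2 ^ (x ^ 2) * k)) := by
      rw [div_eq_mul_one_div] at hye hze
      linear_combination hye - hze
    have h₁ : (1 : ℝ) ≤ |(z : ℝ) - y| := by
      have : (1 : ℤ) ≤ |(z : ℤ) - y| := Int.one_le_abs (by omega)
      exact_mod_cast this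
    have h₂ : |(z : ℝ) - y| ≤ k := by
      have hy' : (y : ℝ) < k := by exact_mod_cast hQ₁ y hyQ
      have hz' : (z : ℝ) < k := by exact_mod_cast hQ₁ z hzQ
      have : (0 : ℝ) ≤ y := y.cast_nonneg
      have : (0 : ℝ) ≤ z := z.cast_nonneg
      exact abs_le.mpr ⟨by linarith, by linarith⟩
    simp only [hdiff, abs_mul, abs_of_pos hw]
    exact ⟨le_mul_of_one_le_left hw.le h₁, mul_le_mul_of_nonneg_right h₂ hw.le⟩
  · intro x hx x' _ hxx'
    have h : (k : ℝ) * k * 2 ^ (x ^ 2) < 2 ^ (x' ^ 2) := by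
      exact_mod_cast sq_mul_two_pow_sq_lt hk2 (hQ₂ x hx) hxx'
    have he : (k : ℝ) * (k * (1 / (2 ^ (x' ^ 2) * k))) = k * k / (2 ^ (x' ^ 2) * k) := by ring
    rw [he, div_lt_div_iff₀ (by positivity) (by positivity)]
    nlinarith


/-- Separator-counting core of Theorem 7 of the paper: a set `S` of at most
`3k/40` separator vertices cannot account for all `|Q₁|·|Q₂| = k²/40` terminal
pairs; some pair `(y, x) ∈ Q₁ × Q₂` has `a_v y + b_v x ≠ D(y,x)` for every
`v ∈ S`, where `D(y,x) = 2x - y + (x - y)/(2^(x²)·k)`. -/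
theorem exists_pair_avoiding_all_separator_vertices
    (k : ℕ) (hk : 0 < k) (h40 : 40 ∣ k)
    (Q₁ Q₂ : Finset ℕ)
    (hQ₁ : ∀ y ∈ Q₁, y ≤ k / 2 - 1)
    (hQ₂ : ∀ x ∈ Q₂, k / 2 ≤ x ∧ x ≤ k - 1)
    (hQ₁c : Q₁.card = k / 5) (hQ₂c : Q₂.card = k / 8)
    {ι : Type*} (S : Finset ι) (hS : S.card ≤ 3 * k / 40)
    (a b : ι → ℕ → ℝ) :
    ∃ y ∈ Q₁, ∃ x ∈ Q₂, ∀ v ∈ S,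
      a v y + b v x ≠
        2 * (x : ℝ) - (y : ℝ) + ((x : ℝ) - (y : ℝ)) / (2 ^ (x ^ 2) * k) := by
  by_contra! hcon
  classical
  obtain ⟨m, rfl⟩ := h40
  have hv : ∀ v ∈ S, _ := fun v _ => sum_card_filter_add_eq_le hk ⟨20 * m, by ring⟩ Q₁ Q₂
    (fun y hy => by have := hQ₁ y hy; omega) (fun x hx => (hQ₂ x hx).1) (by omega) (a v) (b v)
  have hupper := Finset.sum_le_card_nsmul S _ _ hv
  rw [Finset.sum_comm] at hupper
  have hlower : ∀ x ∈ Q₂, Q₁.card ≤ ∑ v ∈ S, (Q₁.filter fun y => a v y + b v x =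
      2 * (x : ℝ) - (y : ℝ) + ((x : ℝ) - (y : ℝ)) / (2 ^ (x ^ 2) * (40 * m : ℕ))).card := by
    intro x hx
    refine le_trans (Finset.card_le_card fun y hy => ?_) Finset.card_biUnion_le
    obtain ⟨v, hvS, he⟩ := hcon y hy x hx
    exact Finset.mem_biUnion.mpr ⟨v, hvS, Finset.mem_filter.mpr ⟨hy, he⟩⟩
  have htotal := (Finset.card_nsmul_le_sum Q₂ _ _ hlower).trans hupper
  have h₁ : Q₁.card = 8 * m := by omega
  have h₂ : Q₂.card = 5 * m := by omega
  have h₃ : S.card ≤ 3 * m := by omega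
  rw [h₁, h₂, smul_eq_mul, smul_eq_mul] at htotal
  have hm : 0 < m := by omega
  nlinarith [Nat.mul_le_mul_right (8 * m + 5 * m) h₃, Nat.mul_pos hm hm]
end
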